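/- Let Q(x) denote the number of ordered pairs (p, q) of primes with p + q ≤ x. Then uniformly for x ≥ 3, Q(x) = x²/(2 ln²x) + O(x²·ln ln x / ln³x); that is, there exists a constant C > 0 such that |Q(x) − x²/(2 ln²x)| ≤ C·x²·ln ln x / ln³x for all x ≥ 3. -/

import Mathlib

open Finset

/-- `Q x` counts ordered pairs `(p, q)` of primes with `p + q ≤ x`. -/
noncomputable def Q (x : ℝ) : ℕ :=
  ((Finset.Icc 1 ⌊x⌋₊ ×ˢ Finset.Icc 1 ⌊x⌋₊).filter
    fun pq => pq.1.Prime ∧ pq.2.Prime ∧ pq.1 + pq.2 ≤ ⌊x⌋₊).card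

open MeasureTheory Complex in
/-- Partial summation for the tail of the zeta series in the half-plane of convergence. -/
theorem riemannZeta_eq_sum_add_of_one_lt_re {N : ℕ} (hN : 1 ≤ N) {s : ℂ} (hs : 1 < s.re) :
    riemannZeta s = ∑ n ∈ Finset.Icc 1 N, (n : ℂ) ^ (-s) + (N : ℂ) ^ (1 - s) / (s - 1)
      - s * ∫ t in Set.Ioi (N : ℝ), ((Int.fract t : ℝ) : ℂ) * (t : ℂ) ^ (-(s + 1)) := by
  have hs0 : s ≠ 0 := by rintro rfl; simp at hs; linarith
  have hs1 : s - 1 ≠ 0 := by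
    intro h; rw [sub_eq_zero] at h; subst h; simp at hs
  have hNpos : (0 : ℝ) < N := by exact_mod_cast hN
  set f : ℕ → ℂ := fun n => if n ≤ N then 0 else 1 with hf
  have hsum1 : LSeriesSummable (1 : ℕ → ℂ) s := LSeriesSummable_one_iff.mpr hs
  have hsumf : LSeriesSummable f s := by
    refine (LSeriesSummable_congr' s ?_).mp hsum1
    filter_upwards [Filter.eventually_gt_atTop N] with n hn
    simp [hf, hn]
  have hpart : ∀ n : ℕ, ∑ k ∈ Finset.Icc 1 n, f k = ((n - N : ℕ) : ℂ) := by
    intro n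
    have : ∑ k ∈ Finset.Icc 1 n, f k =
        ∑ k ∈ (Finset.Icc 1 n).filter (fun k => ¬ k ≤ N), (1 : ℂ) := by
      rw [Finset.sum_filter]; apply Finset.sum_congr rfl
      intro k _; simp only [hf]; split_ifs <;> simp_all
    rw [this]
    have h2 : (Finset.Icc 1 n).filter (fun k => ¬ k ≤ N) = Finset.Ioc N n := by
      ext k; simp; omega
    rw [h2]; simp
  have hL := LSeries_eq_mul_integral f (r := 1) zero_le_one hs hsumf (by
    refine Asymptotics.IsBigO.of_bound 1 (Filter.Eventually.of_forall fun n => ?_)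
    rw [hpart]; simp)
  have hz : riemannZeta s = ∑ n ∈ Finset.Icc 1 N, (n : ℂ) ^ (-s) + LSeries f s := by
    rw [← LSeries_one_eq_riemannZeta hs]
    have e1 : LSeries f s = LSeries 1 s - LSeries (fun n => if n ≤ N then (1 : ℂ) else 0) s := by
      rw [← LSeries_sub hsum1]
      · congr 1; ext n; simp only [hf, Pi.sub_apply, Pi.one_apply]; split_ifs <;> simp
      · refine (LSeriesSummable_congr' s ?_).mp (LSeriesSummable_zero (s := s))
        filter_upwards [Filter.eventually_gt_atTop N] with n hn
        simp [hn]
    rw [e1]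
    have e2 : LSeries (fun n => if n ≤ N then (1 : ℂ) else 0) s =
        ∑ n ∈ Finset.Icc 1 N, (n : ℂ) ^ (-s) := by
      rw [LSeries, tsum_eq_sum (s := Finset.Icc 1 N)]
      · apply Finset.sum_congr rfl
        intro n hn
        simp only [Finset.mem_Icc] at hn
        rw [LSeries.term_of_ne_zero (by omega)]
        simp [hn.2, cpow_neg]
      · intro n hn
        simp only [Finset.mem_Icc, not_and, not_le] at hn
        rcases Nat.eq_zero_or_pos n with rfl | h
        · simp
        · rw [LSeries.term_of_ne_zero (by omega)]
          simp [hn h]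
    rw [e2]; ring
  rw [hz, hL]
  have hint0 : IntegrableOn (fun t : ℝ => (t : ℂ) ^ (-s)) (Set.Ioi (N : ℝ)) :=
    integrableOn_Ioi_cpow_of_lt (by simpa using hs) hNpos
  have hint1 : IntegrableOn (fun t : ℝ => (t : ℂ) ^ (-(s + 1))) (Set.Ioi (N : ℝ)) :=
    integrableOn_Ioi_cpow_of_lt (by simp; linarith) hNpos
  have hint2 : IntegrableOn (fun t : ℝ => ((Int.fract t : ℝ) : ℂ) * (t : ℂ) ^ (-(s + 1)))
      (Set.Ioi (N : ℝ)) := by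
    refine hint1.bdd_mul (c := 1) ?_ ?_
    · exact (measurable_ofReal.comp measurable_fract).aestronglyMeasurable
    · refine Filter.Eventually.of_forall fun t => ?_
      simp only [norm_real, Real.norm_eq_abs, abs_of_nonneg (Int.fract_nonneg t)]
      exact (Int.fract_lt_one t).le
  have hsplit : ∫ t in Set.Ioi (1 : ℝ), (∑ k ∈ Finset.Icc 1 ⌊t⌋₊, f k) * (t : ℂ) ^ (-(s + 1)) =
      ∫ t in Set.Ioi (N : ℝ), ((t : ℂ) ^ (-s) - N * (t : ℂ) ^ (-(s + 1))
        - ((Int.fract t : ℝ) : ℂ) * (t : ℂ) ^ (-(s + 1))) := by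
    rw [setIntegral_eq_of_subset_of_forall_sdiff_eq_zero (t := Set.Ioi (1 : ℝ)) (s := Set.Ioi (N : ℝ))
        measurableSet_Ioi
      (Set.Ioi_subset_Ioi (by exact_mod_cast hN))]
    · refine setIntegral_congr_fun measurableSet_Ioi fun t ht => ?_
      have ht0 : 0 < t := hNpos.trans ht
      have h1 : N ≤ ⌊t⌋₊ := Nat.le_floor (le_of_lt ht)
      have h2 : (t : ℂ) ^ (-s) = t * (t : ℂ) ^ (-(s + 1)) := by
        have : -s = -(s + 1) + 1 := by ring
        rw [this, cpow_add _ _ (by exact_mod_cast ht0.ne'), cpow_one]; ring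
      have h3 : ((Int.fract t : ℝ) : ℂ) = t - (⌊t⌋₊ : ℂ) := by
        have : Int.fract t = t - ⌊t⌋₊ := by
          rw [Int.fract, natCast_floor_eq_intCast_floor ht0.le]
        rw [this]; push_cast; rfl
      simp only [hpart, Nat.cast_sub h1, h2, h3]
      ring
    · intro t ht
      have : ⌊t⌋₊ ≤ N := by
        have := ht.2
        simp only [Set.mem_Ioi, not_lt] at this
        exact Nat.floor_le_of_le this
      simp [hpart, Nat.sub_eq_zero_of_le this]
  rw [hsplit, integral_sub, integral_sub, integral_const_mul,
    integral_Ioi_cpow_of_lt (by simpa using hs) hNpos,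
    integral_Ioi_cpow_of_lt (by simp; linarith) hNpos]
  · have h4 : ((N : ℝ) : ℂ) ^ (-s + 1) = N * (N : ℂ) ^ (-s) := by
      rw [cpow_add _ _ (by exact_mod_cast hNpos.ne'), cpow_one]; push_cast; ring
    have h5 : (N : ℂ) ^ (1 - s) = N * (N : ℂ) ^ (-s) := by
      rw [sub_eq_add_neg, cpow_add _ _ (by exact_mod_cast hNpos.ne'), cpow_one]
    have h6 : -(s + 1) + 1 = -s := by ring
    rw [h4, h5, h6]
    have : -s + 1 ≠ 0 := by
      intro h; apply hs1; linear_combination -h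
    push_cast
    field_simp
    ring
  · exact hint0
  · exact hint1.const_mul _
  · exact hint0.sub (hint1.const_mul _)
  · exact hint2

open MeasureTheory Complex in
theorem differentiableAt_integral_fract_mul_cpow {N : ℕ} (hN : 1 ≤ N) {s : ℂ} (hs : 0 < s.re) :
    DifferentiableAt ℂ (fun s : ℂ =>
      ∫ t in Set.Ioi (N : ℝ), ((Int.fract t : ℝ) : ℂ) * (t : ℂ) ^ (-(s + 1))) s := by
  have hNpos : (0 : ℝ) < N := by exact_mod_cast hN
  set f : ℝ → ℂ := (Set.Ioi (N : ℝ)).indicator fun t => ((Int.fract t : ℝ) : ℂ) with hf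
  have hbound : ∀ t, ‖f t‖ ≤ 1 := by
    intro t
    rw [hf]
    by_cases h : t ∈ Set.Ioi (N : ℝ)
    · rw [Set.indicator_of_mem h, norm_real, Real.norm_eq_abs, abs_of_nonneg (Int.fract_nonneg t)]
      exact (Int.fract_lt_one t).le
    · rw [Set.indicator_of_notMem h]; simp
  have hmeas : Measurable f :=
    (measurable_ofReal.comp measurable_fract).indicator measurableSet_Ioi
  have hloc : LocallyIntegrableOn f (Set.Ioi 0) := by
    refine LocallyIntegrable.locallyIntegrableOn ?_ _
    refine (locallyIntegrable_const (1 : ℝ)).mono hmeas.aestronglyMeasurable ?_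
    exact Filter.Eventually.of_forall fun t => by simpa using hbound t
  have hmel : DifferentiableAt ℂ (mellin f) (-s) := by
    refine mellin_differentiableAt_of_isBigO_rpow (a := 0) (b := (-s).re - 1) hloc ?_
      (by simpa using hs) ?_ (by linarith)
    · refine Asymptotics.IsBigO.of_bound 1 (Filter.Eventually.of_forall fun t => ?_)
      simpa using hbound t
    · refine Filter.EventuallyEq.trans_isBigO (f₂ := fun _ => (0 : ℂ)) ?_
        (Asymptotics.isBigO_zero _ _)
      have : Set.Iio (N : ℝ) ∈ nhdsWithin (0 : ℝ) (Set.Ioi 0) :=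
        mem_nhdsWithin_of_mem_nhds (Iio_mem_nhds hNpos)
      filter_upwards [this] with t ht
      rw [hf, Set.indicator_of_notMem]
      simp only [Set.mem_Ioi, not_lt]; exact le_of_lt ht
  have heq : (fun s : ℂ => ∫ t in Set.Ioi (N : ℝ), ((Int.fract t : ℝ) : ℂ) * (t : ℂ) ^ (-(s + 1)))
      = fun s => mellin f (-s) := by
    ext z
    rw [mellin, setIntegral_eq_of_subset_of_forall_sdiff_eq_zero (t := Set.Ioi (0 : ℝ))
      (s := Set.Ioi (N : ℝ)) measurableSet_Ioi (Set.Ioi_subset_Ioi hNpos.le)]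
    · refine setIntegral_congr_fun measurableSet_Ioi fun t ht => ?_
      simp only [hf, Set.indicator_of_mem ht, smul_eq_mul]
      rw [mul_comm]; congr 2; ring
    · intro t ht
      simp only [hf, Set.indicator_of_notMem ht.2, smul_zero]
  rw [heq]
  exact DifferentiableAt.comp s (f := fun z : ℂ => -z) hmel differentiableAt_id.neg

open MeasureTheory Complex in
theorem norm_integral_fract_mul_cpow_le {N : ℕ} (hN : 1 ≤ N) {s : ℂ} (hs : 0 < s.re) :
    ‖∫ t in Set.Ioi (N : ℝ), ((Int.fract t : ℝ) : ℂ) * (t : ℂ) ^ (-(s + 1))‖ ≤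
      (N : ℝ) ^ (-s.re) / s.re := by
  have hNpos : (0 : ℝ) < N := by exact_mod_cast hN
  have h : ∫ t in Set.Ioi (N : ℝ), t ^ (-(s.re + 1)) = (N : ℝ) ^ (-s.re) / s.re := by
    rw [integral_Ioi_rpow_of_lt (by linarith) hNpos]
    have : -(s.re + 1) + 1 = -s.re := by ring
    rw [this, neg_div_neg_eq]
  rw [← h]
  refine norm_integral_le_of_norm_le (integrableOn_Ioi_rpow_of_lt (by linarith) hNpos) ?_
  refine (ae_restrict_iff' measurableSet_Ioi).mpr (Filter.Eventually.of_forall fun t ht => ?_)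
  have ht0 : 0 < t := hNpos.trans ht
  rw [norm_mul, norm_cpow_eq_rpow_re_of_pos ht0, norm_real, Real.norm_eq_abs,
    abs_of_nonneg (Int.fract_nonneg t)]
  simp only [neg_re, add_re, one_re]
  exact mul_le_of_le_one_left (Real.rpow_nonneg ht0.le _) (Int.fract_lt_one t).le

open MeasureTheory Complex in
/-- The truncated zeta series with its integral remainder, valid for `0 < s.re`. -/
theorem riemannZeta_eq_sum_add_of_re_pos {N : ℕ} (hN : 1 ≤ N) {s : ℂ} (hs : 0 < s.re)
    (hs1 : s ≠ 1) :
    riemannZeta s = ∑ n ∈ Finset.Icc 1 N, (n : ℂ) ^ (-s) + (N : ℂ) ^ (1 - s) / (s - 1)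
      - s * ∫ t in Set.Ioi (N : ℝ), ((Int.fract t : ℝ) : ℂ) * (t : ℂ) ^ (-(s + 1)) := by
  set I : ℂ → ℂ := fun s =>
    ∫ t in Set.Ioi (N : ℝ), ((Int.fract t : ℝ) : ℂ) * (t : ℂ) ^ (-(s + 1)) with hI
  set U : Set ℂ := {z | 0 < z.re} with hU
  have hUo : IsOpen U := isOpen_lt continuous_const continuous_re
  have hUc : IsPreconnected U := (convex_halfSpace_re_gt 0).isPreconnected
  have hN0 : (N : ℂ) ≠ 0 := by exact_mod_cast (by omega : N ≠ 0)
  have hf : AnalyticOnNhd ℂ riemannZeta₁ U :=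
    differentiable_riemannZeta₁.differentiableOn.analyticOnNhd hUo
  have hg : AnalyticOnNhd ℂ (fun z => (z - 1) * ∑ n ∈ Finset.Icc 1 N, (n : ℂ) ^ (-z)
      + (N : ℂ) ^ (1 - z) - (z - 1) * (z * I z)) U := by
    refine DifferentiableOn.analyticOnNhd (fun z hz => ?_) hUo
    refine DifferentiableAt.differentiableWithinAt ?_
    have hd := differentiableAt_integral_fract_mul_cpow hN (s := z) hz
    refine DifferentiableAt.sub (DifferentiableAt.add (DifferentiableAt.mul (by fun_prop) ?_) ?_)
      (DifferentiableAt.mul (by fun_prop) (DifferentiableAt.mul (by fun_prop) hd))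
    · refine DifferentiableAt.fun_sum fun n hn => ?_
      have : (n : ℂ) ≠ 0 := by
        have := (Finset.mem_Icc.mp hn).1
        exact_mod_cast (by omega : n ≠ 0)
      exact (differentiableAt_id.neg).const_cpow (Or.inl this)
    · exact DifferentiableAt.const_cpow (by fun_prop) (Or.inl hN0)
  have key := hf.eqOn_of_preconnected_of_eventuallyEq hg hUc (z₀ := 2) (by simp [hU]) (by
    have : {z : ℂ | 1 < z.re} ∈ nhds (2 : ℂ) :=
      (isOpen_lt continuous_const continuous_re).mem_nhds (by simp)
    filter_upwards [this] with z hz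
    have hz1 : z ≠ 1 := by rintro rfl; simp at hz
    have hz' : z - 1 ≠ 0 := sub_ne_zero.mpr hz1
    have h := riemannZeta_eq_sum_add_of_one_lt_re hN hz
    rw [riemannZeta_eq_inv_sub_mul hz1] at h
    have h2 : riemannZeta₁ z = (z - 1) * ((z - 1)⁻¹ * riemannZeta₁ z) := by field_simp
    rw [h2, h]
    field_simp
    simp only [hI])
  have h := key (show s ∈ U from hs)
  have hz' : s - 1 ≠ 0 := sub_ne_zero.mpr hs1
  rw [riemannZeta_eq_inv_sub_mul hs1, h]
  field_simp
  simp only [hI]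

theorem norm_riemannZeta_le_rpow {s : ℂ} (h1 : 39 / 40 ≤ s.re) (h2 : s.re ≤ 3)
    (ht : 1 ≤ |s.im|) : ‖riemannZeta s‖ ≤ 51 * |s.im| ^ (1 / 20 : ℝ) := by
  set x := |s.im| with hx
  have hs1 : s ≠ 1 := by rintro rfl; simp [hx] at ht; linarith
  set N := ⌊x⌋₊ with hN
  have hN1 : 1 ≤ N := Nat.le_floor (by simpa using ht)
  have hx0 : 0 < x := by linarith
  have hNx : (N : ℝ) ≤ x := Nat.floor_le hx0.le
  have hNx2 : x ≤ 2 * N := by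
    have := Nat.lt_floor_add_one x
    have h3 : (1 : ℝ) ≤ N := by exact_mod_cast hN1
    rw [← hN] at this
    linarith
  have hN0 : (0 : ℝ) < N := by exact_mod_cast hN1
  have hN1' : (1 : ℝ) ≤ N := by exact_mod_cast hN1
  have hNp : (N : ℝ) ^ (1 / 40 : ℝ) ≤ x ^ (1 / 40 : ℝ) := Real.rpow_le_rpow hN0.le hNx (by norm_num)
  have hxp : x ^ (1 / 20 : ℝ) = x ^ (1 / 40 : ℝ) * x ^ (1 / 40 : ℝ) := by
    rw [← Real.rpow_add hx0]; norm_num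
  have hx1 : 1 ≤ x ^ (1 / 40 : ℝ) := Real.one_le_rpow ht (by norm_num)
  rw [riemannZeta_eq_sum_add_of_re_pos hN1 (by linarith) hs1]
  have hA : ‖∑ n ∈ Finset.Icc 1 N, (n : ℂ) ^ (-s)‖ ≤ 41 * x ^ (1 / 20 : ℝ) := by
    have hb : ∀ n ∈ Finset.Icc 1 N, ‖(n : ℂ) ^ (-s)‖ ≤ x ^ (1 / 40 : ℝ) * (n : ℝ)⁻¹ := by
      intro n hn
      rw [Finset.mem_Icc] at hn
      have hn0 : (0 : ℝ) < n := by exact_mod_cast hn.1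
      rw [Complex.norm_natCast_cpow_of_pos hn.1]
      calc (n : ℝ) ^ (-s).re ≤ (n : ℝ) ^ (1 / 40 + (-1) : ℝ) :=
            Real.rpow_le_rpow_of_exponent_le (by exact_mod_cast hn.1) (by
              simp only [Complex.neg_re]; linarith)
        _ = (n : ℝ) ^ (1 / 40 : ℝ) * (n : ℝ)⁻¹ := by rw [Real.rpow_add hn0, Real.rpow_neg_one]
        _ ≤ _ := by
            gcongr
            exact le_trans (by exact_mod_cast hn.2) hNx
    have hh : ∑ n ∈ Finset.Icc 1 N, (n : ℝ)⁻¹ ≤ 41 * x ^ (1 / 40 : ℝ) := by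
      have h3 := harmonic_le_one_add_log N
      rw [harmonic_eq_sum_Icc] at h3
      push_cast at h3
      have h4 : Real.log N ≤ (N : ℝ) ^ (1 / 40 : ℝ) / (1 / 40) :=
        Real.log_le_rpow_div hN0.le (by norm_num)
      linarith
    calc _ ≤ ∑ n ∈ Finset.Icc 1 N, x ^ (1 / 40 : ℝ) * (n : ℝ)⁻¹ := norm_sum_le_of_le _ hb
      _ = x ^ (1 / 40 : ℝ) * ∑ n ∈ Finset.Icc 1 N, (n : ℝ)⁻¹ := by rw [Finset.mul_sum]
      _ ≤ x ^ (1 / 40 : ℝ) * (41 * x ^ (1 / 40 : ℝ)) := by gcongr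
      _ = _ := by rw [hxp]; ring
  have hB : ‖(N : ℂ) ^ (1 - s) / (s - 1)‖ ≤ x ^ (1 / 20 : ℝ) := by
    have h3 : 1 ≤ ‖s - 1‖ := by
      have := Complex.abs_im_le_norm (s - 1)
      simp only [Complex.sub_im, Complex.one_im, sub_zero] at this
      linarith
    rw [norm_div, Complex.norm_natCast_cpow_of_pos hN1]
    calc (N : ℝ) ^ (1 - s).re / ‖s - 1‖ ≤ (N : ℝ) ^ (1 - s).re :=
          div_le_self (Real.rpow_nonneg hN0.le _) h3
      _ ≤ (N : ℝ) ^ (1 / 40 : ℝ) :=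
          Real.rpow_le_rpow_of_exponent_le hN1' (by simp; linarith)
      _ ≤ _ := by rw [hxp]; nlinarith
  have hC : ‖s * ∫ t in Set.Ioi (N : ℝ), ((Int.fract t : ℝ) : ℂ) * (t : ℂ) ^ (-(s + 1))‖
      ≤ 9 * x ^ (1 / 20 : ℝ) := by
    have h3 : ‖s‖ ≤ 4 * x := by
      have := Complex.norm_le_abs_re_add_abs_im s
      rw [abs_of_nonneg (by linarith : 0 ≤ s.re)] at this
      linarith
    have h4 : (N : ℝ) ^ (-s.re) / s.re ≤ x ^ (1 / 40 : ℝ) * (2 / x) * (40 / 39) := by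
      have : (N : ℝ) ^ (-s.re) ≤ x ^ (1 / 40 : ℝ) * (2 / x) := by
        calc (N : ℝ) ^ (-s.re) ≤ (N : ℝ) ^ (1 / 40 + (-1) : ℝ) :=
            Real.rpow_le_rpow_of_exponent_le hN1' (by linarith)
        _ = (N : ℝ) ^ (1 / 40 : ℝ) * (N : ℝ)⁻¹ := by rw [Real.rpow_add hN0, Real.rpow_neg_one]
        _ ≤ _ := by
            gcongr
            rw [inv_le_comm₀ hN0 (by positivity), inv_div]
            linarith
      calc _ ≤ x ^ (1 / 40 : ℝ) * (2 / x) / (39 / 40) := by gcongr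
        _ = _ := by ring
    rw [norm_mul]
    calc _ ≤ (4 * x) * (x ^ (1 / 40 : ℝ) * (2 / x) * (40 / 39)) :=
          mul_le_mul h3 ((norm_integral_fract_mul_cpow_le hN1 (by linarith)).trans h4)
            (norm_nonneg _) (by positivity)
      _ = (320 / 39) * x ^ (1 / 40 : ℝ) := by field_simp; norm_num
      _ ≤ _ := by rw [hxp]; nlinarith
  calc _ ≤ _ := norm_sub_le _ _
    _ ≤ _ := by
      have := norm_add_le (∑ n ∈ Finset.Icc 1 N, (n : ℂ) ^ (-s)) ((N : ℂ) ^ (1 - s) / (s - 1))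
      linarith

theorem norm_riemannZeta_ofReal_le {x : ℝ} (hx : 0 < x) (hx1 : x ≤ 1) :
    ‖riemannZeta (1 + x)‖ ≤ 3 / x := by
  have h : (1 : ℂ) + x ≠ 1 := by simpa using hx.ne'
  have hre : ((1 : ℂ) + x).re = 1 + x := by simp
  have hI := norm_integral_fract_mul_cpow_le (N := 1) le_rfl (s := 1 + x) (by rw [hre]; linarith)
  rw [riemannZeta_eq_sum_add_of_re_pos (N := 1) le_rfl (by rw [hre]; linarith) h]
  rw [hre] at hI
  simp only [Finset.Icc_self, Finset.sum_singleton, Nat.cast_one, Complex.one_cpow,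
    Real.one_rpow] at hI ⊢
  have hn : ‖(1 : ℂ) + x‖ = 1 + x := by
    rw [show (1 : ℂ) + x = ((1 + x : ℝ) : ℂ) by push_cast; rfl, Complex.norm_real,
      Real.norm_eq_abs, abs_of_pos (by linarith)]
  have h2 : ‖(1 : ℂ) / (1 + x - 1)‖ = 1 / x := by
    rw [show (1 : ℂ) + x - 1 = x by ring, norm_div, Complex.norm_real, Real.norm_eq_abs,
      abs_of_pos hx, norm_one]
  have h3 := norm_sub_le ((1 : ℂ) + 1 / (1 + x - 1)) ((1 + x) *
    ∫ t in Set.Ioi (1 : ℝ), ((Int.fract t : ℝ) : ℂ) * (t : ℂ) ^ (-((1 : ℂ) + x + 1)))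
  have h4 := norm_add_le (1 : ℂ) (1 / (1 + x - 1))
  rw [h2, norm_one] at h4
  rw [norm_mul, hn] at h3
  have h5 := mul_le_mul_of_nonneg_left hI (by linarith : 0 ≤ 1 + x)
  rw [mul_one_div_cancel (by linarith)] at h5
  have h6 : 1 ≤ 1 / x := by rw [le_div_iff₀ hx]; linarith
  have h7 : 3 / x = 3 * (1 / x) := by ring
  rw [h7]
  linarith

theorem two_mul_rpow_one_div_twenty_le {a b : ℝ} (ha : 0 ≤ a) (hb : 0 ≤ b) (h : a ≤ 2 * b) :
    a ^ (1 / 20 : ℝ) ≤ 2 * b ^ (1 / 20 : ℝ) := by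
  calc a ^ (1 / 20 : ℝ) ≤ (2 * b) ^ (1 / 20 : ℝ) := Real.rpow_le_rpow ha h (by norm_num)
    _ = 2 ^ (1 / 20 : ℝ) * b ^ (1 / 20 : ℝ) := Real.mul_rpow (by norm_num) hb
    _ ≤ 2 * b ^ (1 / 20 : ℝ) := by
      gcongr
      calc (2 : ℝ) ^ (1 / 20 : ℝ) ≤ 2 ^ (1 : ℝ) :=
            Real.rpow_le_rpow_of_exponent_le (by norm_num) (by norm_num)
        _ = 2 := Real.rpow_one 2

theorem norm_deriv_riemannZeta_le_rpow {s : ℂ} (h1 : 79 / 80 ≤ s.re) (h2 : s.re ≤ 2)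
    (ht : 2 ≤ |s.im|) : ‖deriv riemannZeta s‖ ≤ 8160 * |s.im| ^ (1 / 20 : ℝ) := by
  have hz : ∀ z ∈ Metric.closedBall s (1 / 80), |z.re - s.re| ≤ 1 / 80 ∧
      |z.im - s.im| ≤ 1 / 80 := by
    intro z hz
    rw [Metric.mem_closedBall, dist_eq_norm] at hz
    have h3 := Complex.abs_re_le_norm (z - s)
    have h4 := Complex.abs_im_le_norm (z - s)
    rw [Complex.sub_re] at h3
    rw [Complex.sub_im] at h4
    exact ⟨h3.trans hz, h4.trans hz⟩
  have him : ∀ z ∈ Metric.closedBall s (1 / 80), 1 ≤ |z.im| ∧ |z.im| ≤ 2 * |s.im| := by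
    intro z hz'
    have h3 := (hz z hz').2
    have h4 := abs_sub_abs_le_abs_sub z.im s.im
    have h5 := abs_sub_abs_le_abs_sub s.im z.im
    rw [abs_sub_comm s.im] at h5
    constructor <;> linarith
  have hd : DifferentiableOn ℂ riemannZeta (Metric.closedBall s (1 / 80)) := by
    intro z hz'
    refine (differentiableAt_riemannZeta ?_).differentiableWithinAt
    rintro rfl
    have := (him _ hz').1
    simp at this
    linarith
  have := Complex.norm_deriv_le_of_forall_mem_sphere_norm_le (c := s) (R := 1 / 80)
    (C := 102 * |s.im| ^ (1 / 20 : ℝ)) (f := riemannZeta) (by norm_num)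
    (hd.diffContOnCl_ball subset_rfl) (by
      intro z hz'
      have hz'' := Metric.sphere_subset_closedBall hz'
      have h3 := abs_le.mp (hz z hz'').1
      obtain ⟨h4, h5⟩ := him z hz''
      have h6 := norm_riemannZeta_le_rpow (s := z) (by linarith) (by linarith) h4
      have h7 := two_mul_rpow_one_div_twenty_le (abs_nonneg z.im) (abs_nonneg s.im) h5
      linarith)
  calc _ ≤ _ := this
    _ = _ := by ring

theorem norm_riemannZeta_pow_four_ge {x y : ℝ} (hx : 0 < x) (hx1 : x ≤ 1) (hy : 1 ≤ |y|) :
    x ^ 3 / (4096 * |y| ^ (1 / 20 : ℝ)) ≤ ‖riemannZeta (1 + x + Complex.I * y)‖ ^ 4 := by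
  have h := DirichletCharacter.norm_LFunction_product_ge_one (N := 1) (1 : DirichletCharacter ℂ 1)
      hx y
  rw [DirichletCharacter.LFunctionTrivChar, DirichletCharacter.LFunction_modOne_eq,
    DirichletCharacter.LFunction_modOne_eq, norm_mul, norm_mul, norm_pow, norm_pow] at h
  have h1 := norm_riemannZeta_ofReal_le hx hx1
  have him : ((1 : ℂ) + x + 2 * Complex.I * y).im = 2 * y := by simp
  have h2 := norm_riemannZeta_le_rpow (s := 1 + x + 2 * Complex.I * y) (by simp; linarith)
    (by simp; linarith) (by rw [him, abs_mul]; norm_num; linarith)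
  have h3 : |((1 : ℂ) + x + 2 * Complex.I * y).im| ^ (1 / 20 : ℝ) ≤ 2 * |y| ^ (1 / 20 : ℝ) := by
    refine two_mul_rpow_one_div_twenty_le (abs_nonneg _) (abs_nonneg _) ?_
    rw [him, abs_mul]; norm_num
  set T := |y| ^ (1 / 20 : ℝ) with hT
  have hT0 : 0 < T := by positivity
  set Z := ‖riemannZeta (1 + x + Complex.I * y)‖ with hZ
  have h4 : (1 : ℝ) ≤ (3 / x) ^ 3 * Z ^ 4 * (102 * T) := by
    calc (1 : ℝ) ≤ _ := h
      _ ≤ (3 / x) ^ 3 * Z ^ 4 * (102 * T) := by gcongr; linarith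
  rw [div_le_iff₀ (by positivity)]
  have h5 : (3 / x) ^ 3 * Z ^ 4 * (102 * T) = 2754 * (Z ^ 4 * T) / x ^ 3 := by
    field_simp; ring
  rw [h5, le_div_iff₀ (by positivity)] at h4
  have : 0 ≤ Z ^ 4 * T := by positivity
  linarith

/-- A zero-free region for the zeta function with a quantitative lower bound. -/
theorem exists_le_norm_riemannZeta :
    ∃ c : ℝ, 0 < c ∧ c ≤ 1 / 80 ∧ ∀ s : ℂ, 2 ≤ |s.im| →
      1 - c / (|s.im| ^ (1 / 20 : ℝ)) ^ 5 ≤ s.re → s.re ≤ 2 →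
      c / (|s.im| ^ (1 / 20 : ℝ)) ^ 4 ≤ ‖riemannZeta s‖ := by
  refine ⟨(1 / 262144) ^ 4, by norm_num, by norm_num, fun s ht h1 h2 => ?_⟩
  set c : ℝ := 1 / 262144 with hc
  have hc0 : 0 < c := by norm_num [hc]
  set T := |s.im| ^ (1 / 20 : ℝ) with hT
  have hT1 : 1 ≤ T := Real.one_le_rpow (by linarith) (by norm_num)
  have hT0 : 0 < T := by linarith
  have hlow : ∀ x : ℝ, c ^ 4 / T ^ 5 ≤ x → x ≤ 1 →
      c ^ 3 / (8 * T ^ 4) ≤ ‖riemannZeta (1 + x + Complex.I * s.im)‖ := by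
    intro x hx hx1
    have hx0 : 0 < x := lt_of_lt_of_le (by positivity) hx
    refine le_of_pow_le_pow_left₀ (n := 4) (by norm_num) (norm_nonneg _) ?_
    refine le_trans ?_ (norm_riemannZeta_pow_four_ge hx0 hx1 (by linarith))
    rw [← hT]
    calc (c ^ 3 / (8 * T ^ 4)) ^ 4 = (c ^ 4 / T ^ 5) ^ 3 / (4096 * T) := by field_simp; norm_num
      _ ≤ _ := by gcongr
  have hη : c ^ 4 / T ^ 5 ≤ 1 / 80 := by
    calc c ^ 4 / T ^ 5 ≤ c ^ 4 := div_le_self (by positivity) (one_le_pow₀ hT1)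
      _ ≤ 1 / 80 := by norm_num [hc]
  have hη0 : 0 < c ^ 4 / T ^ 5 := by positivity
  have hs : s = 1 + (s.re - 1 : ℝ) + Complex.I * s.im := by
    apply Complex.ext <;> simp
  by_cases hcase : 1 + c ^ 4 / T ^ 5 ≤ s.re
  · have := hlow (s.re - 1) (by linarith) (by linarith)
    rw [← hs] at this
    refine le_trans ?_ this
    rw [div_le_div_iff₀ (by positivity) (by positivity)]
    have : c ^ 4 * 8 ≤ c ^ 3 := by norm_num [hc]
    nlinarith [pow_pos hT0 4]
  · push Not at hcase
    set w : ℂ := 1 + (c ^ 4 / T ^ 5 : ℝ) + Complex.I * s.im with hw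
    have hw1 := hlow (c ^ 4 / T ^ 5) le_rfl (by linarith)
    rw [← hw] at hw1
    have hwre : w.re = 1 + c ^ 4 / T ^ 5 :=
      by simp only [hw]; simp [-Complex.ofReal_div, -Complex.ofReal_pow]
    have hwim : w.im = s.im := by simp only [hw]; simp [-Complex.ofReal_div, -Complex.ofReal_pow]
    have hseg : ∀ z ∈ segment ℝ s w, s.re ≤ z.re ∧ z.re ≤ w.re ∧ z.im = s.im := by
      rintro z ⟨a, b, ha, hb, hab, rfl⟩
      simp only [Complex.add_re, Complex.add_im, Complex.smul_re, Complex.smul_im, smul_eq_mul,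
        hwim]
      refine ⟨?_, ?_, by rw [← add_mul, hab, one_mul]⟩
      · have : a = 1 - b := by linarith
        subst this; nlinarith
      · have : b = 1 - a := by linarith
        subst this; nlinarith
    have hdiff := Convex.norm_image_sub_le_of_norm_deriv_le (𝕜 := ℂ) (f := riemannZeta)
      (C := 8160 * T)
      (s := segment ℝ s w) (x := s) (y := w) (fun z hz => by
        refine differentiableAt_riemannZeta ?_
        rintro rfl
        have := (hseg _ hz).2.2
        rw [← this] at ht
        simp at ht; linarith)
      (fun z hz => by
        obtain ⟨h3, h4, h5⟩ := hseg z hz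
        have := norm_deriv_riemannZeta_le_rpow (s := z) (by linarith) (by linarith)
          (by rw [h5]; exact ht)
        rwa [h5] at this)
      (convex_segment s w) (left_mem_segment ℝ s w) (right_mem_segment ℝ s w)
    have hdist : ‖w - s‖ ≤ 2 * (c ^ 4 / T ^ 5) := by
      have := Complex.norm_le_abs_re_add_abs_im (w - s)
      rw [Complex.sub_re, Complex.sub_im, hwim, sub_self, abs_zero, add_zero, hwre,
        abs_of_nonneg (by linarith)] at this
      linarith
    have h3 : ‖riemannZeta w - riemannZeta s‖ ≤ c ^ 3 / (16 * T ^ 4) := by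
      calc _ ≤ _ := hdiff
        _ ≤ 8160 * T * (2 * (c ^ 4 / T ^ 5)) := by gcongr
        _ = 16320 * c * (c ^ 3 / T ^ 4) := by field_simp; norm_num
        _ ≤ (1 / 16) * (c ^ 3 / T ^ 4) := by gcongr; norm_num [hc]
        _ = _ := by field_simp
    have h4 := norm_sub_norm_le (riemannZeta w) (riemannZeta s)
    have h5 : c ^ 3 / (8 * T ^ 4) = 2 * (c ^ 3 / (16 * T ^ 4)) := by field_simp; norm_num
    have h6 : c ^ 4 / T ^ 4 ≤ c ^ 3 / (16 * T ^ 4) := by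
      rw [div_le_div_iff₀ (by positivity) (by positivity)]
      have : c ^ 4 * 16 ≤ c ^ 3 := by norm_num [hc]
      nlinarith [pow_pos hT0 4]
    linarith

theorem riemannZeta₁_ne_zero_of_riemannZeta_ne_zero {s : ℂ} (hs1 : s ≠ 1)
    (hs : riemannZeta s ≠ 0) : riemannZeta₁ s ≠ 0 := by
  intro h
  rw [riemannZeta_eq_inv_sub_mul hs1, h, mul_zero] at hs
  exact hs rfl

theorem riemannZeta₁_ne_zero_of_one_le_re {s : ℂ} (hs : 1 ≤ s.re) : riemannZeta₁ s ≠ 0 := by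
  by_cases h : s = 1
  · subst h; simp
  · exact riemannZeta₁_ne_zero_of_riemannZeta_ne_zero h (riemannZeta_ne_zero_of_one_le_re hs)

theorem logDeriv_riemannZeta₁ {s : ℂ} (hs1 : s ≠ 1) (hs : riemannZeta s ≠ 0) :
    logDeriv riemannZeta₁ s = deriv riemannZeta s / riemannZeta s + 1 / (s - 1) := by
  have h0 : s - 1 ≠ 0 := sub_ne_zero.mpr hs1
  have h := riemannZeta₁_ne_zero_of_riemannZeta_ne_zero hs1 hs
  rw [deriv_riemannZeta_eq_neg_inv_sub_sq_mul_add hs1, riemannZeta_eq_inv_sub_mul hs1,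
    logDeriv_apply]
  field_simp
  ring

/-- Polynomial growth of the regularised third derivative of `ζ'/ζ` to the right of `Re s = 1`. -/
theorem exists_norm_iteratedDeriv_logDeriv_riemannZeta₁_le :
    ∃ C : ℝ, 0 < C ∧ ∀ s : ℂ, 1 ≤ s.re → s.re ≤ 3 / 2 →
      ‖iteratedDeriv 3 (logDeriv riemannZeta₁) s‖ ≤ C * (1 + |s.im|) := by
  obtain ⟨c, hc0, hc1, hc⟩ := exists_le_norm_riemannZeta
  have hcont : ContinuousOn (iteratedDeriv 3 (logDeriv riemannZeta₁))
      (Set.Icc 1 (3 / 2) ×ℂ Set.Icc (-3) 3) := by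
    intro s hs
    rw [Complex.mem_reProdIm] at hs
    have ha : AnalyticAt ℂ riemannZeta₁ s := differentiable_riemannZeta₁.analyticAt s
    have : AnalyticAt ℂ (logDeriv riemannZeta₁) s :=
      ha.deriv.div ha (riemannZeta₁_ne_zero_of_one_le_re hs.1.1)
    rw [iteratedDeriv_eq_iterate]
    exact (this.iterated_deriv 3).continuousAt.continuousWithinAt
  obtain ⟨B, hB⟩ := (isCompact_Icc.reProdIm isCompact_Icc).exists_bound_of_continuousOn hcont
  set C1 : ℝ := 8160 / c + 1 with hC1
  have hC1' : 0 < C1 := by positivity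
  refine ⟨|B| + 6 * (32 * C1) * (32 / c) ^ 3, by positivity, fun s h1 h2 => ?_⟩
  by_cases h3 : |s.im| ≤ 3
  · have := hB s (by
      rw [Complex.mem_reProdIm]
      exact ⟨⟨h1, h2⟩, abs_le.mp h3⟩)
    calc _ ≤ B := this
      _ ≤ |B| := le_abs_self B
      _ ≤ |B| + 6 * (32 * C1) * (32 / c) ^ 3 :=
        by linarith [show 0 ≤ 6 * (32 * C1) * (32 / c) ^ 3 by positivity]
      _ ≤ _ := le_mul_of_one_le_right (by positivity) (by linarith [abs_nonneg s.im])
  · push Not at h3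
    set T := |s.im| ^ (1 / 20 : ℝ) with hT
    have hT1 : 1 ≤ T := Real.one_le_rpow (by linarith) (by norm_num)
    have hT0 : 0 < T := by linarith
    set r := c / (32 * T ^ 5) with hr
    have hr0 : 0 < r := by positivity
    have hr1 : r ≤ 1 / 80 := by
      calc r ≤ c := div_le_self hc0.le (by linarith [one_le_pow₀ hT1 (n := 5)])
        _ ≤ _ := hc1
    have hz : ∀ z ∈ Metric.closedBall s r, 2 ≤ |z.im| ∧ z.re ≤ 2 ∧ 79 / 80 ≤ z.re ∧
        |z.im| ^ (1 / 20 : ℝ) ≤ 2 * T ∧ 1 - c / (|z.im| ^ (1 / 20 : ℝ)) ^ 5 ≤ z.re := by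
      intro z hz
      rw [Metric.mem_closedBall, dist_eq_norm] at hz
      have h4 := (Complex.abs_re_le_norm (z - s)).trans hz
      have h5 := (Complex.abs_im_le_norm (z - s)).trans hz
      rw [Complex.sub_re] at h4
      rw [Complex.sub_im] at h5
      have h6 := abs_sub_abs_le_abs_sub z.im s.im
      have h7 := abs_sub_abs_le_abs_sub s.im z.im
      rw [abs_sub_comm s.im] at h7
      have h8 := abs_le.mp h4
      have h9 : |z.im| ^ (1 / 20 : ℝ) ≤ 2 * T :=
        two_mul_rpow_one_div_twenty_le (abs_nonneg _) (abs_nonneg _) (by linarith)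
      have h10 : 0 < |z.im| ^ (1 / 20 : ℝ) := Real.rpow_pos_of_pos (by linarith) _
      refine ⟨by linarith, by linarith, by linarith, h9, ?_⟩
      have : r ≤ c / (|z.im| ^ (1 / 20 : ℝ)) ^ 5 := by
        rw [hr]
        gcongr
        calc (|z.im| ^ (1 / 20 : ℝ)) ^ 5 ≤ (2 * T) ^ 5 := by gcongr
          _ = 32 * T ^ 5 := by ring
      linarith
    have hne : ∀ z ∈ Metric.closedBall s r, z ≠ 1 ∧ riemannZeta z ≠ 0 := by
      intro z hz'
      obtain ⟨h4, h5, h6, h7, h8⟩ := hz z hz'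
      have h10 : 0 < |z.im| ^ (1 / 20 : ℝ) := Real.rpow_pos_of_pos (by linarith) _
      constructor
      · rintro rfl
        simp at h4; linarith
      · have := hc z h4 h8 h5
        rw [← norm_pos_iff]
        exact lt_of_lt_of_le (by positivity) this
    have hd : DifferentiableOn ℂ (logDeriv riemannZeta₁) (Metric.closedBall s r) := by
      intro z hz'
      have ha : AnalyticAt ℂ riemannZeta₁ z := differentiable_riemannZeta₁.analyticAt z
      exact (ha.deriv.div ha (riemannZeta₁_ne_zero_of_riemannZeta_ne_zero (hne z hz').1
        (hne z hz').2)).differentiableAt.differentiableWithinAt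
    have hmain := Complex.norm_iteratedDeriv_le_of_forall_mem_sphere_norm_le (c := s) (R := r)
      (C := 32 * C1 * T ^ 5) (f := logDeriv riemannZeta₁) 3 hr0
        (hd.diffContOnCl_ball subset_rfl) (by
        intro z hz'
        have hz'' := Metric.sphere_subset_closedBall hz'
        obtain ⟨h4, h5, h6, h7, h8⟩ := hz z hz''
        rw [logDeriv_riemannZeta₁ (hne z hz'').1 (hne z hz'').2]
        have h9 := norm_deriv_riemannZeta_le_rpow h6 h5 h4
        have h10 := hc z h4 h8 h5
        set S := |z.im| ^ (1 / 20 : ℝ) with hS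
        have hS1 : 1 ≤ S := Real.one_le_rpow (by linarith) (by norm_num)
        have hS0 : 0 < S := by linarith
        have h11 : ‖deriv riemannZeta z / riemannZeta z‖ ≤ 8160 / c * S ^ 5 := by
          rw [norm_div]
          calc _ ≤ 8160 * S / (c / S ^ 4) := by gcongr
            _ = _ := by field_simp
        have h12 : ‖1 / (z - 1)‖ ≤ 1 := by
          rw [norm_div, norm_one]
          have := Complex.abs_im_le_norm (z - 1)
          simp only [Complex.sub_im, Complex.one_im, sub_zero] at this
          rw [div_le_one (by linarith)]
          linarith
        have h13 : 1 ≤ S ^ 5 := one_le_pow₀ hS1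
        calc _ ≤ _ := norm_add_le _ _
          _ ≤ 8160 / c * S ^ 5 + S ^ 5 := by linarith
          _ = C1 * S ^ 5 := by ring
          _ ≤ C1 * (2 * T) ^ 5 := by gcongr
          _ = _ := by ring)
    have hT20 : T ^ 20 = |s.im| := by
      rw [hT, ← Real.rpow_natCast, ← Real.rpow_mul (abs_nonneg _)]
      norm_num
    calc _ ≤ _ := hmain
      _ = 6 * (32 * C1) * (32 / c) ^ 3 * T ^ 20 := by
        rw [hr]; norm_num [Nat.factorial]; field_simp
      _ = 6 * (32 * C1) * (32 / c) ^ 3 * |s.im| := by rw [hT20]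
      _ ≤ _ := by
        have h0 : 0 < 6 * (32 * C1) * (32 / c) ^ 3 := by positivity
        have := mul_nonneg (abs_nonneg B) (by linarith [abs_nonneg s.im] : 0 ≤ 1 + |s.im|)
        nlinarith

/-- On `Re s > 1` the Dirichlet series of `Λ log³` has a pole of order four at `1` with an explicit
regular part. -/
theorem hasSum_vonMangoldt_mul_log_pow_three {s : ℂ} (hs : 1 < s.re) :
    HasSum (fun n : ℕ ↦ ((ArithmeticFunction.vonMangoldt n * Real.log n ^ 3 : ℝ) : ℂ) *
      Complex.exp (-s * (Real.log n : ℝ)))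
      (6 / (s - 1) ^ 4 + iteratedDeriv 3 (logDeriv riemannZeta₁) s) := by
  have habs : LSeries.abscissaOfAbsConv (fun n ↦ ((ArithmeticFunction.vonMangoldt n : ℝ) : ℂ))
      < s.re := by
    refine lt_of_le_of_lt (b := ((1 : ℝ) : EReal)) ?_ (by exact_mod_cast hs)
    refine LSeries.abscissaOfAbsConv_le_of_forall_lt_LSeriesSummable fun y hy ↦ ?_
    exact ArithmeticFunction.LSeriesSummable_vonMangoldt (by simpa using hy)
  have hsum : LSeriesSummable
      (LSeries.logMul^[3] (fun n ↦ ((ArithmeticFunction.vonMangoldt n : ℝ) : ℂ))) s :=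
    LSeriesSummable_of_abscissaOfAbsConv_lt_re (by rwa [LSeries.absicssaOfAbsConv_logPowMul])
  have hder := LSeries_iteratedDeriv 3 habs
  have hev : LSeries (fun n ↦ ((ArithmeticFunction.vonMangoldt n : ℝ) : ℂ)) =ᶠ[nhds s]
      (fun z ↦ (1 * z - 1)⁻¹) - logDeriv riemannZeta₁ := by
    filter_upwards [(isOpen_lt continuous_const Complex.continuous_re).mem_nhds hs] with z hz
    have hz1 : z ≠ 1 := by rintro rfl; simp at hz
    have := logDeriv_riemannZeta₁ hz1 (riemannZeta_ne_zero_of_one_le_re (le_of_lt hz))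
    rw [ArithmeticFunction.LSeries_vonMangoldt_eq_deriv_riemannZeta_div hz, Pi.sub_apply, this]
    simp only [one_mul, one_div]
    ring
  have hs1 : s - 1 ≠ 0 := by
    intro h
    rw [sub_eq_zero.mp h] at hs; simp at hs
  have ha : AnalyticAt ℂ riemannZeta₁ s := differentiable_riemannZeta₁.analyticAt s
  have hb : AnalyticAt ℂ (logDeriv riemannZeta₁) s :=
    ha.deriv.div ha (riemannZeta₁_ne_zero_of_one_le_re hs.le)
  have hc : AnalyticAt ℂ (fun z : ℂ ↦ (1 * z - 1)⁻¹) s := by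
    refine AnalyticAt.inv (by fun_prop) (by simpa using hs1)
  rw [hev.iteratedDeriv_eq, iteratedDeriv_sub hc.contDiffAt hb.contDiffAt,
    iteratedDeriv_eq_iterate (f := fun z : ℂ ↦ (1 * z - 1)⁻¹), iter_deriv_inv_linear_sub] at hder
  have hval : LSeries (LSeries.logMul^[3] (fun n ↦ ((ArithmeticFunction.vonMangoldt n : ℝ) : ℂ))) s
      = 6 / (s - 1) ^ 4 + iteratedDeriv 3 (logDeriv riemannZeta₁) s := by
    have h4 : (1 * s - 1) ^ (-1 - (3 : ℕ) : ℤ) = 1 / (s - 1) ^ 4 := by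
      rw [show (-1 - (3 : ℕ) : ℤ) = -((4 : ℕ) : ℤ) by norm_num, zpow_neg, zpow_natCast, one_mul,
        one_div]
    beta_reduce at hder
    rw [h4] at hder
    norm_num [Nat.factorial, -Function.iterate_succ] at hder
    linear_combination hder
  rw [← hval]
  refine HasSum.congr_fun hsum.hasSum fun n ↦ ?_
  rcases Nat.eq_zero_or_pos n with rfl | hn
  · simp
  · have hn0 : (n : ℂ) ≠ 0 := by exact_mod_cast hn.ne'
    rw [LSeries.term_of_ne_zero hn.ne', Complex.cpow_def_of_ne_zero hn0, div_eq_mul_inv,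
      ← Complex.exp_neg, ← Complex.natCast_log]
    simp only [Function.iterate_succ, Function.iterate_zero, Function.comp_apply, id,
      LSeries.logMul, ← Complex.natCast_log]
    push_cast
    ring_nf

open MeasureTheory in
/-- A nonnegative bump function together with its (rapidly decaying) inverse Fourier
representation. -/
theorem exists_bump_fourier_representation :
    ∃ (G : ℝ → ℝ) (g : ℝ → ℂ), Continuous G ∧ (∀ v, 0 ≤ G v) ∧ (∀ v, 1 < |v| → G v = 0) ∧
      ∫ v, G v = 1 ∧ Continuous g ∧ Integrable g ∧ Integrable (fun t ↦ |t| * ‖g t‖) ∧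
      ∀ v : ℝ, (G v : ℂ) = ∫ t : ℝ, Complex.exp (2 * Real.pi * (t * v) * Complex.I) * g t := by
  let b : ContDiffBump (0 : ℝ) := ⟨1 / 2, 1, by norm_num, by norm_num⟩
  have hsupp : HasCompactSupport (fun v ↦ (b.normed volume v : ℂ)) :=
    b.hasCompactSupport_normed.comp_left (g := ((↑) : ℝ → ℂ)) Complex.ofReal_zero
  have hsm : ContDiff ℝ ((⊤ : ℕ∞) : WithTop ℕ∞) (fun v ↦ (b.normed volume v : ℂ)) :=
    Complex.ofRealCLM.contDiff.comp b.contDiff_normed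
  let f : SchwartzMap ℝ ℂ := hsupp.toSchwartzMap hsm
  have hf : ∀ v, f v = (b.normed volume v : ℂ) := fun v ↦ rfl
  refine ⟨b.normed volume, FourierTransform.fourier f,
    (b.contDiff_normed (n := 0)).continuous, b.nonneg_normed, ?_, b.integral_normed,
    (FourierTransform.fourier f).continuous, (FourierTransform.fourier f).integrable, ?_, ?_⟩
  · intro v hv
    rw [← Function.notMem_support, b.support_normed_eq]
    simpa using hv.le
  · simpa using SchwartzMap.integrable_pow_mul volume (FourierTransform.fourier f) 1
  · intro v
    have h := f.continuous.fourierInv_fourier_eq f.integrable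
      (by rw [← SchwartzMap.fourier_coe]; exact SchwartzMap.integrable _)
    rw [← hf, ← congrFun h v, Real.fourierInv_eq']
    refine integral_congr_ae (Filter.Eventually.of_forall fun t ↦ ?_)
    simp [SchwartzMap.fourier_coe, mul_comm]

open MeasureTheory in
theorem integrableOn_pow_three_mul_exp_neg_mul {a : ℝ} (ha : 0 < a) :
    IntegrableOn (fun y : ℝ ↦ y ^ 3 * Real.exp (-a * y)) (Set.Ioi 0) := by
  have h := integrableOn_rpow_mul_exp_neg_mul_rpow (p := 1) (s := 3) (b := a)
    (by norm_num) (by norm_num) ha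
  refine h.congr_fun (fun y hy ↦ ?_) measurableSet_Ioi
  simp only [Real.rpow_one]
  congr 1
  exact_mod_cast Real.rpow_natCast y 3

open MeasureTheory Filter in
theorem integral_pow_three_mul_cexp_neg_mul {z : ℂ} (hz : 0 < z.re) :
    ∫ y : ℝ in Set.Ioi 0, (y : ℂ) ^ 3 * Complex.exp (-z * y) = 6 / z ^ 4 := by
  have hz0 : z ≠ 0 := by rintro rfl; simp at hz
  have hint : IntegrableOn (fun y : ℝ ↦ (y : ℂ) ^ 3 * Complex.exp (-z * y)) (Set.Ioi 0) := by
    refine (integrableOn_pow_three_mul_exp_neg_mul hz).mono'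
      (Continuous.aestronglyMeasurable (by fun_prop)) ?_
    refine (ae_restrict_mem measurableSet_Ioi).mono fun y hy ↦ ?_
    rw [norm_mul, Complex.norm_exp, norm_pow, Complex.norm_real, Real.norm_eq_abs,
      abs_of_pos hy]
    simp
  have hderiv : ∀ y ∈ Set.Ici (0 : ℝ), HasDerivAt (fun y : ℝ ↦
      -((y : ℂ) ^ 3 * (1 / z) + (y : ℂ) ^ 2 * (3 / z ^ 2) + (y : ℂ) ^ 1 * (6 / z ^ 3)
        + (y : ℂ) ^ 0 * (6 / z ^ 4)) * Complex.exp (-z * y))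
      ((y : ℂ) ^ 3 * Complex.exp (-z * y)) y := by
    intro y _
    have h1 : HasDerivAt (fun y : ℝ ↦ (y : ℂ)) 1 y := Complex.ofRealCLM.hasDerivAt
    have h2 := ((((((h1.pow 3).mul_const (1 / z)).add ((h1.pow 2).mul_const (3 / z ^ 2))).add
      ((h1.pow 1).mul_const (6 / z ^ 3))).add ((h1.pow 0).mul_const (6 / z ^ 4))).neg).mul
      ((h1.const_mul (-z)).cexp)
    refine h2.congr_deriv ?_
    simp only [Pi.add_apply, Pi.pow_apply, Pi.neg_apply]
    field_simp
    push_cast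
    ring
  have hlim : ∀ (k : ℕ) (c : ℂ), Tendsto (fun y : ℝ ↦ (y : ℂ) ^ k * c * Complex.exp (-z * y))
      atTop (nhds 0) := by
    intro k c
    have h := (tendsto_rpow_mul_exp_neg_mul_atTop_nhds_zero k z.re hz).mul_const ‖c‖
    rw [zero_mul] at h
    refine squeeze_zero_norm' ?_ h
    filter_upwards [eventually_ge_atTop 0] with y hy
    rw [norm_mul, norm_mul, Complex.norm_exp, norm_pow, Complex.norm_real, Real.norm_eq_abs,
      abs_of_nonneg hy, Real.rpow_natCast]
    apply le_of_eq
    simp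
    ring
  have htend := ((((hlim 3 (1 / z)).add (hlim 2 (3 / z ^ 2))).add (hlim 1 (6 / z ^ 3))).add
    (hlim 0 (6 / z ^ 4))).neg
  have h := integral_Ioi_of_hasDerivAt_of_tendsto' hderiv hint
    (htend.congr fun y ↦ by ring)
  rw [h]
  simp

open MeasureTheory in
/-- Smoothed explicit formula to the right of the line `Re s = 1`. -/
theorem exists_smoothed_sum_sub_integral_le {G : ℝ → ℝ} {g : ℝ → ℂ} (hg : Continuous g)
    (hgi : Integrable g) (hgt : Integrable (fun t ↦ |t| * ‖g t‖))
    (hG : ∀ v : ℝ, (G v : ℂ) = ∫ t : ℝ, Complex.exp (2 * Real.pi * (t * v) * Complex.I) * g t) :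
    ∃ K : ℝ, 0 < K ∧ ∀ σ h u : ℝ, 1 < σ → σ ≤ 3 / 2 → 0 < h → h ≤ 1 →
      ∃ S : ℝ, HasSum (fun n : ℕ ↦ ArithmeticFunction.vonMangoldt n * Real.log n ^ 3 *
          Real.exp (-σ * Real.log n) * G ((Real.log n - u) / h)) S ∧
        |S - ∫ y in Set.Ioi 0, y ^ 3 * Real.exp (-(σ - 1) * y) * G ((y - u) / h)| ≤ K / h := by
  obtain ⟨C, hC0, hC⟩ := exists_norm_iteratedDeriv_logDeriv_riemannZeta₁_le
  have hJi : Integrable (fun t ↦ (1 + |t|) * ‖g t‖) := by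
    refine (hgi.norm.add hgt).congr (Filter.Eventually.of_forall fun t ↦ ?_)
    simp only [Pi.add_apply]
    ring
  set J := ∫ t, (1 + |t|) * ‖g t‖ with hJ
  have hJ0 : 0 ≤ J := integral_nonneg fun t ↦ by positivity
  refine ⟨C * (2 * Real.pi) * J + 1, by positivity, fun σ h u hσ hσ2 hh hh1 ↦ ?_⟩
  set s : ℝ → ℂ := fun t ↦ σ - 2 * Real.pi * (t / h) * Complex.I with hs
  have hs_re : ∀ t, (s t).re = σ := fun t ↦ by
    simp [hs, ← Complex.ofReal_div]
  have hs_im : ∀ t, (s t).im = -(2 * Real.pi * (t / h)) := fun t ↦ by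
    simp [hs, ← Complex.ofReal_div]
  have hs_cont : Continuous s := by fun_prop
  set w : ℝ → ℂ := fun t ↦ Complex.exp (-(2 * Real.pi * (t * (u / h)) * Complex.I)) * g t with hw
  have hw_norm : ∀ t, ‖w t‖ = ‖g t‖ := fun t ↦ by
    rw [hw, norm_mul, Complex.norm_exp]
    simp [← Complex.ofReal_div]
  have hw_cont : Continuous w := by fun_prop
  have hwi : Integrable w := hgi.mono hw_cont.aestronglyMeasurable
    (Filter.Eventually.of_forall fun t ↦ (hw_norm t).le)
  -- the Fourier representation of a translated and scaled bump
  have hrep : ∀ y : ℝ, ∫ t, Complex.exp (-s t * y) * w t =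
      Complex.exp (-σ * y) * G ((y - u) / h) := by
    intro y
    rw [hG, ← integral_const_mul]
    refine integral_congr_ae (Filter.Eventually.of_forall fun t ↦ ?_)
    simp only [hw, hs]
    rw [← mul_assoc, ← mul_assoc (Complex.exp _) (Complex.exp _), ← Complex.exp_add,
      ← Complex.exp_add]
    congr 2
    push_cast
    ring
  set a : ℕ → ℝ := fun n ↦ ArithmeticFunction.vonMangoldt n * Real.log n ^ 3 with ha
  have ha0 : ∀ n, 0 ≤ a n := fun n ↦
    mul_nonneg ArithmeticFunction.vonMangoldt_nonneg (pow_nonneg (Real.log_natCast_nonneg n) 3)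
  have hL : ∀ t, HasSum (fun n : ℕ ↦ (a n : ℂ) * Complex.exp (-s t * (Real.log n : ℝ)))
      (6 / (s t - 1) ^ 4 + iteratedDeriv 3 (logDeriv riemannZeta₁) (s t)) := fun t ↦
    hasSum_vonMangoldt_mul_log_pow_three (by rw [hs_re]; exact hσ)
  have hnormexp : ∀ t y : ℝ, ‖Complex.exp (-s t * y)‖ = Real.exp (-σ * y) := fun t y ↦ by
    rw [Complex.norm_exp]
    simp [hs_re]
  set F : ℕ → ℝ → ℂ := fun n t ↦ (a n : ℂ) * Complex.exp (-s t * (Real.log n : ℝ)) * w t with hF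
  have hF_norm : ∀ n t, ‖F n t‖ = a n * Real.exp (-σ * Real.log n) * ‖g t‖ := fun n t ↦ by
    rw [hF, norm_mul, norm_mul, hnormexp, hw_norm, Complex.norm_real, Real.norm_eq_abs,
      abs_of_nonneg (ha0 n)]
  have hF_int : ∀ n, Integrable (F n) := fun n ↦ by
    refine (hgi.norm.const_mul (a n * Real.exp (-σ * Real.log n))).mono'
      (Continuous.aestronglyMeasurable (by fun_prop)) ?_
    exact Filter.Eventually.of_forall fun t ↦ (hF_norm n t).le
  have hF_sum : Summable fun n ↦ ∫ t, ‖F n t‖ := by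
    simp only [hF_norm, integral_const_mul]
    refine Summable.mul_right _ ?_
    have := (hL 0).summable.norm
    refine this.congr fun n ↦ ?_
    rw [norm_mul, hnormexp, Complex.norm_real, Real.norm_eq_abs, abs_of_nonneg (ha0 n)]
  have hmain := hasSum_integral_of_summable_integral_norm hF_int hF_sum
  have htsum : ∀ t, ∑' n, F n t = 6 / (s t - 1) ^ 4 * w t +
      iteratedDeriv 3 (logDeriv riemannZeta₁) (s t) * w t := fun t ↦ by
    rw [((hL t).mul_right (w t)).tsum_eq, add_mul]
  have hFint : ∀ n, ∫ t, F n t = ((a n * Real.exp (-σ * Real.log n) *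
      G ((Real.log n - u) / h) : ℝ) : ℂ) := fun n ↦ by
    simp only [hF, mul_assoc, integral_const_mul, hrep]
    push_cast
    ring
  -- the error term
  have hR_bound : ∀ t, ‖iteratedDeriv 3 (logDeriv riemannZeta₁) (s t) * w t‖ ≤
      C * (2 * Real.pi) / h * ((1 + |t|) * ‖g t‖) := by
    intro t
    rw [norm_mul, hw_norm, ← mul_assoc]
    refine mul_le_mul_of_nonneg_right ?_ (norm_nonneg _)
    refine (hC (s t) (by rw [hs_re]; exact hσ.le) (by rw [hs_re]; exact hσ2)).trans ?_
    rw [hs_im, abs_neg, abs_mul, abs_div, abs_of_pos hh, abs_of_pos (by positivity), mul_div_assoc,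
      mul_assoc C]
    refine mul_le_mul_of_nonneg_left ?_ hC0.le
    have h1 : (1 : ℝ) ≤ 2 * Real.pi / h := by
      rw [le_div_iff₀ hh]
      nlinarith [Real.pi_gt_three]
    calc 1 + 2 * Real.pi * (|t| / h) ≤ 2 * Real.pi / h + 2 * Real.pi * (|t| / h) := by gcongr
      _ = _ := by ring
  have hR_cont : Continuous fun t ↦ iteratedDeriv 3 (logDeriv riemannZeta₁) (s t) := by
    rw [continuous_iff_continuousAt]
    intro t
    have h1 : AnalyticAt ℂ riemannZeta₁ (s t) := differentiable_riemannZeta₁.analyticAt _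
    have h2 : AnalyticAt ℂ (logDeriv riemannZeta₁) (s t) :=
      h1.deriv.div h1 (riemannZeta₁_ne_zero_of_one_le_re (by rw [hs_re]; exact hσ.le))
    have h3 : ContinuousAt (iteratedDeriv 3 (logDeriv riemannZeta₁)) (s t) := by
      rw [iteratedDeriv_eq_iterate]
      exact (h2.iterated_deriv 3).continuousAt
    exact ContinuousAt.comp (f := s) h3 hs_cont.continuousAt
  have hR_int : Integrable fun t ↦ iteratedDeriv 3 (logDeriv riemannZeta₁) (s t) * w t :=
    (hJi.const_mul _).mono' (hR_cont.mul hw_cont).aestronglyMeasurable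
      (Filter.Eventually.of_forall hR_bound)
  -- the main term
  have hpole : ∀ t, ∫ y : ℝ in Set.Ioi 0, (y : ℂ) ^ 3 * Complex.exp (-(s t - 1) * y) =
      6 / (s t - 1) ^ 4 := fun t ↦
    integral_pow_three_mul_cexp_neg_mul (by rw [Complex.sub_re, hs_re]; simpa using hσ)
  have hprod : Integrable (Function.uncurry fun (t : ℝ) (y : ℝ) ↦
      (y : ℂ) ^ 3 * Complex.exp (-(s t - 1) * y) * w t)
      (volume.prod (volume.restrict (Set.Ioi 0))) := by
    have h1 := hgi.norm.mul_prod (integrableOn_pow_three_mul_exp_neg_mul (sub_pos.mpr hσ)).norm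
    refine h1.mono' (Continuous.aestronglyMeasurable ?_) ?_
    · unfold Function.uncurry
      fun_prop
    · refine Filter.Eventually.of_forall fun z ↦ ?_
      simp only [Function.uncurry]
      rw [norm_mul, hw_norm, norm_mul, norm_mul, Complex.norm_exp, norm_pow, norm_pow,
        Complex.norm_real, Real.norm_eq_abs (Real.exp _), Real.abs_exp]
      simp [hs_re]
      linarith
  have hswap := integral_integral_swap hprod
  have hpw_int : Integrable fun t ↦ 6 / (s t - 1) ^ 4 * w t := by
    have := hprod.integral_prod_left
    refine this.congr (Filter.Eventually.of_forall fun t ↦ ?_)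
    simp only [Function.uncurry]
    rw [integral_mul_const, hpole]
  have hmainterm : ∫ t, 6 / (s t - 1) ^ 4 * w t =
      ((∫ y in Set.Ioi 0, y ^ 3 * Real.exp (-(σ - 1) * y) * G ((y - u) / h) : ℝ) : ℂ) := by
    rw [← integral_complex_ofReal]
    calc _ = ∫ t, ∫ y : ℝ in Set.Ioi 0, (y : ℂ) ^ 3 * Complex.exp (-(s t - 1) * y) * w t := by
          refine integral_congr_ae (Filter.Eventually.of_forall fun t ↦ ?_)
          simp only
          rw [integral_mul_const, hpole]
      _ = _ := by
          rw [hswap]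
          refine integral_congr_ae (Filter.Eventually.of_forall fun y ↦ ?_)
          simp only
          calc _ = ∫ t, ((y : ℂ) ^ 3 * Complex.exp y) * (Complex.exp (-s t * y) * w t) := by
                refine integral_congr_ae (Filter.Eventually.of_forall fun t ↦ ?_)
                simp only
                rw [show -(s t - 1) * (y : ℂ) = y + -s t * y by ring, Complex.exp_add]
                ring
            _ = _ := by
                rw [integral_const_mul, hrep]
                push_cast
                rw [show -((σ : ℂ) - 1) * (y : ℂ) = y + -σ * y by ring, Complex.exp_add]
                ring
  simp only [hFint, htsum] at hmain
  rw [integral_add hpw_int hR_int, hmainterm] at hmain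
  have hre := Complex.hasSum_re hmain
  simp only [Complex.ofReal_re, Complex.add_re] at hre
  refine ⟨_, hre, ?_⟩
  rw [add_sub_cancel_left]
  refine (Complex.abs_re_le_norm _).trans ?_
  refine (norm_integral_le_of_norm_le (hJi.const_mul (C * (2 * Real.pi) / h))
    (Filter.Eventually.of_forall hR_bound)).trans ?_
  rw [integral_const_mul, ← hJ, div_mul_eq_mul_div]
  gcongr
  linarith

open MeasureTheory in
/-- Smoothed explicit formula on the line `Re s = 1`. -/
theorem exists_smoothed_sum_div_sub_integral_le {G : ℝ → ℝ} {g : ℝ → ℂ} (hGc : Continuous G)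
    (hGs : ∀ v, 1 < |v| → G v = 0) (hg : Continuous g)
    (hgi : Integrable g) (hgt : Integrable (fun t ↦ |t| * ‖g t‖))
    (hG : ∀ v : ℝ, (G v : ℂ) = ∫ t : ℝ, Complex.exp (2 * Real.pi * (t * v) * Complex.I) * g t) :
    ∃ K : ℝ, 0 < K ∧ ∀ (h u B : ℝ) (N : ℕ), 0 < h → h ≤ 1 → 0 ≤ B → u + 1 ≤ B →
      Real.exp (u + 1) ≤ N →
      |∑ n ∈ Icc 1 N, ArithmeticFunction.vonMangoldt n * Real.log n ^ 3 / n *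
          G ((Real.log n - u) / h) - ∫ y in (0 : ℝ)..B, y ^ 3 * G ((y - u) / h)| ≤ K / h := by
  obtain ⟨K, hK0, hK⟩ := exists_smoothed_sum_sub_integral_le hg hgi hgt hG
  refine ⟨K, hK0, fun h u B N hh hh1 hB huB hN ↦ ?_⟩
  have hvan : ∀ y, u + 1 < y → G ((y - u) / h) = 0 := fun y hy ↦ by
    refine hGs _ (lt_of_lt_of_le ?_ (le_abs_self _))
    rw [lt_div_iff₀ hh]
    linarith
  set Φ : ℝ → ℝ := fun σ ↦ ∑ n ∈ Icc 1 N, ArithmeticFunction.vonMangoldt n * Real.log n ^ 3 *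
      Real.exp (-σ * Real.log n) * G ((Real.log n - u) / h) -
      ∫ y in (0 : ℝ)..B, y ^ 3 * Real.exp (-(σ - 1) * y) * G ((y - u) / h) with hΦ
  have hΦc : Continuous Φ := by
    refine Continuous.sub (by fun_prop) ?_
    refine intervalIntegral.continuous_parametric_intervalIntegral_of_continuous' ?_ 0 B
    unfold Function.uncurry
    fun_prop
  have hbound : ∀ᶠ σ in nhdsWithin (1 : ℝ) (Set.Ioi 1), |Φ σ| ≤ K / h := by
    filter_upwards [Ioc_mem_nhdsGT (show (1 : ℝ) < 3 / 2 by norm_num)] with σ hσ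
    obtain ⟨S, hS, hSb⟩ := hK σ h u hσ.1 hσ.2 hh hh1
    have hfin : HasSum (fun n : ℕ ↦ ArithmeticFunction.vonMangoldt n * Real.log n ^ 3 *
        Real.exp (-σ * Real.log n) * G ((Real.log n - u) / h))
        (∑ n ∈ Icc 1 N, ArithmeticFunction.vonMangoldt n * Real.log n ^ 3 *
        Real.exp (-σ * Real.log n) * G ((Real.log n - u) / h)) := by
      refine hasSum_sum_of_ne_finset_zero fun n hn ↦ ?_
      rcases Nat.eq_zero_or_pos n with rfl | hn0
      · simp
      · have hNn : N < n := by
          by_contra hcon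
          exact hn (mem_Icc.mpr ⟨hn0, not_lt.mp hcon⟩)
        rw [hvan, mul_zero]
        rw [Real.lt_log_iff_exp_lt (by exact_mod_cast hn0)]
        exact hN.trans_lt (by exact_mod_cast hNn)
    have hint : ∫ y in Set.Ioi 0, y ^ 3 * Real.exp (-(σ - 1) * y) * G ((y - u) / h) =
        ∫ y in (0 : ℝ)..B, y ^ 3 * Real.exp (-(σ - 1) * y) * G ((y - u) / h) := by
      rw [intervalIntegral.integral_of_le hB]
      refine setIntegral_eq_of_subset_of_forall_sdiff_eq_zero measurableSet_Ioi
        Set.Ioc_subset_Ioi_self fun y hy ↦ ?_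
      have : B < y := by
        by_contra hcon
        exact hy.2 ⟨hy.1, not_lt.mp hcon⟩
      rw [hvan y (huB.trans_lt this), mul_zero]
    rw [hS.unique hfin, hint] at hSb
    exact hSb
  have hlim := le_of_tendsto ((hΦc.abs.tendsto 1).mono_left nhdsWithin_le_nhds) hbound
  refine le_trans (le_of_eq ?_) hlim
  rw [hΦ]
  congr 2
  · refine sum_congr rfl fun n hn ↦ ?_
    have hn0 : (0 : ℝ) < n := by exact_mod_cast (mem_Icc.mp hn).1
    rw [neg_one_mul, Real.exp_neg, Real.exp_log hn0, div_eq_mul_inv]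
  · simp

/-- The weight obtained by averaging the translates of a rescaled bump against `exp`. -/
noncomputable def expSmoothing (G : ℝ → ℝ) (h U y : ℝ) : ℝ :=
  ∫ u in (-1 : ℝ)..U, Real.exp u / h * G ((y - u) / h)

theorem intervalIntegral_inv_mul_comp_sub_div (G : ℝ → ℝ) (h a b y : ℝ) :
    ∫ u in a..b, 1 / h * G ((y - u) / h) = ∫ v in (y - b) / h..(y - a) / h, G v := by
  have := intervalIntegral.inv_smul_integral_comp_sub_div (a := a) (b := b) G h (y / h)
  rw [smul_eq_mul, ← intervalIntegral.integral_const_mul] at this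
  simp only [sub_div, one_div, this]

open MeasureTheory in
theorem integrable_of_forall_one_lt_abs {G : ℝ → ℝ} (hGc : Continuous G)
    (hGs : ∀ v, 1 < |v| → G v = 0) : Integrable G := by
  refine hGc.integrable_of_hasCompactSupport (HasCompactSupport.intro (isCompact_Icc (a := -1)
    (b := 1)) fun v hv ↦ hGs v ?_)
  by_contra hcon
  exact hv (abs_le.mp (not_lt.mp hcon))

open MeasureTheory in
theorem expSmoothing_le {G : ℝ → ℝ} (hGc : Continuous G) (hG0 : ∀ v, 0 ≤ G v)
    (hGs : ∀ v, 1 < |v| → G v = 0) (hG1 : ∫ v, G v = 1) {h U : ℝ} (hh : 0 < h) (hU : -1 ≤ U)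
    (y : ℝ) :
    expSmoothing G h U y ≤ Real.exp (y + h) := by
  have hc1 : Continuous fun u ↦ Real.exp u / h * G ((y - u) / h) := by fun_prop
  have hc2 : Continuous fun u ↦ Real.exp (y + h) * (1 / h * G ((y - u) / h)) := by fun_prop
  calc expSmoothing G h U y
      ≤ ∫ u in (-1 : ℝ)..U, Real.exp (y + h) * (1 / h * G ((y - u) / h)) := by
        refine intervalIntegral.integral_mono_on hU (hc1.intervalIntegrable _ _)
          (hc2.intervalIntegrable _ _) fun u _ ↦ ?_
        by_cases hu : u ≤ y + h
        · rw [← mul_assoc, mul_one_div]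
          have := hG0 ((y - u) / h)
          gcongr
        · rw [hGs, mul_zero, mul_zero, mul_zero]
          rw [lt_abs]
          right
          rw [← neg_div, lt_div_iff₀ hh]
          linarith
    _ = Real.exp (y + h) * ∫ v in (y - U) / h..(y - -1) / h, G v := by
        rw [intervalIntegral.integral_const_mul, intervalIntegral_inv_mul_comp_sub_div]
    _ ≤ Real.exp (y + h) * 1 := by
        refine mul_le_mul_of_nonneg_left ?_ (Real.exp_nonneg _)
        rw [intervalIntegral.integral_of_le (by gcongr), ← hG1]
        exact setIntegral_le_integral (integrable_of_forall_one_lt_abs hGc hGs)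
          (Filter.Eventually.of_forall hG0)
    _ = _ := mul_one _

theorem expSmoothing_nonneg {G : ℝ → ℝ} (hG0 : ∀ v, 0 ≤ G v) {h U : ℝ} (hh : 0 < h) (hU : -1 ≤ U)
    (y : ℝ) :
    0 ≤ expSmoothing G h U y :=
  intervalIntegral.integral_nonneg hU fun u _ ↦ mul_nonneg (by positivity) (hG0 _)

theorem expSmoothing_eq_zero {G : ℝ → ℝ} (hGs : ∀ v, 1 < |v| → G v = 0) {h U y : ℝ} (hh : 0 < h)
    (hU : -1 ≤ U) (hy : U + h < y) :
    expSmoothing G h U y = 0 := by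
  unfold expSmoothing
  rw [intervalIntegral.integral_congr (g := fun _ ↦ 0), intervalIntegral.integral_zero]
  intro u hu
  rw [Set.uIcc_of_le hU] at hu
  simp only
  rw [hGs, mul_zero]
  rw [lt_abs]
  left
  rw [lt_div_iff₀ hh]
  linarith [hu.2]

open MeasureTheory in
theorem le_expSmoothing {G : ℝ → ℝ} (hGc : Continuous G) (hG0 : ∀ v, 0 ≤ G v)
    (hGs : ∀ v, 1 < |v| → G v = 0) (hG1 : ∫ v, G v = 1) {h U y : ℝ} (hh : 0 < h) (hh1 : h ≤ 1)
    (hy0 : 0 ≤ y)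
    (hy : y ≤ U - h) : Real.exp (y - h) ≤ expSmoothing G h U y := by
  have hc1 : Continuous fun u ↦ Real.exp u / h * G ((y - u) / h) := by fun_prop
  have hc2 : Continuous fun u ↦ Real.exp (y - h) * (1 / h * G ((y - u) / h)) := by fun_prop
  have hint : ∫ v in (y - U) / h..(y - -1) / h, G v = 1 := by
    refine Eq.trans ?_ hG1
    have h1 : (y - U) / h ≤ -1 := by rw [div_le_iff₀ hh]; linarith
    have h2 : 1 ≤ (y - -1) / h := by rw [le_div_iff₀ hh]; linarith
    rw [intervalIntegral.integral_of_le (by linarith), ← integral_Icc_eq_integral_Ioc]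
    refine setIntegral_eq_integral_of_forall_compl_eq_zero fun v hv ↦ hGs v ?_
    by_contra hcon
    have := abs_le.mp (not_lt.mp hcon)
    exact hv ⟨by linarith [this.1], by linarith [this.2]⟩
  calc Real.exp (y - h) = Real.exp (y - h) * ∫ v in (y - U) / h..(y - -1) / h, G v := by
        rw [hint, mul_one]
    _ = ∫ u in (-1 : ℝ)..U, Real.exp (y - h) * (1 / h * G ((y - u) / h)) := by
        rw [intervalIntegral.integral_const_mul, intervalIntegral_inv_mul_comp_sub_div]
    _ ≤ _ := by
        refine intervalIntegral.integral_mono_on (by linarith) (hc2.intervalIntegrable _ _)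
          (hc1.intervalIntegrable _ _) fun u _ ↦ ?_
        by_cases hu : y - h ≤ u
        · rw [← mul_assoc, mul_one_div]
          have := hG0 ((y - u) / h)
          gcongr
        · rw [hGs, mul_zero, mul_zero, mul_zero]
          rw [lt_abs]
          left
          rw [lt_div_iff₀ hh]
          linarith

theorem continuous_expSmoothing {G : ℝ → ℝ} (hGc : Continuous G) (h U : ℝ) : Continuous
    (expSmoothing G h U) := by
  refine intervalIntegral.continuous_parametric_intervalIntegral_of_continuous' ?_ _ _
  unfold Function.uncurry
  fun_prop

open MeasureTheory in
/-- The explicit formula averaged against the weight `expSmoothing`. -/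
theorem abs_sum_mul_expSmoothing_sub_integral_le {G : ℝ → ℝ} (hGc : Continuous G) {a : ℕ → ℝ}
    {K h U : ℝ} {N : ℕ} (hh : 0 < h) (hU : 0 ≤ U)
    (hK : ∀ u ∈ Set.Icc (-1) U, |∑ n ∈ Icc 1 N, a n * G ((Real.log n - u) / h) -
      ∫ y in (0 : ℝ)..U + 1, y ^ 3 * G ((y - u) / h)| ≤ K / h) :
    |∑ n ∈ Icc 1 N, a n * expSmoothing G h U (Real.log n) -
      ∫ y in (0 : ℝ)..U + 1, y ^ 3 * expSmoothing G h U y| ≤ K / h ^ 2 * Real.exp U := by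
  have hK0 : 0 ≤ K / h := (abs_nonneg _).trans (hK U ⟨by linarith, le_rfl⟩)
  have hcont : ∀ y, Continuous fun u ↦ Real.exp u / h * G ((y - u) / h) := fun y ↦ by fun_prop
  have hsum : ∑ n ∈ Icc 1 N, a n * expSmoothing G h U (Real.log n) =
      ∫ u in (-1 : ℝ)..U, ∑ n ∈ Icc 1 N, a n * (Real.exp u / h * G ((Real.log n - u) / h)) := by
    rw [intervalIntegral.integral_finsetSum fun (n : ℕ) _ ↦
      ((hcont (Real.log n)).const_mul (a n)).intervalIntegrable _ _]
    simp only [intervalIntegral.integral_const_mul, expSmoothing]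
  have hint : ∫ y in (0 : ℝ)..U + 1, y ^ 3 * expSmoothing G h U y =
      ∫ u in (-1 : ℝ)..U, ∫ y in (0 : ℝ)..U + 1,
        y ^ 3 * (Real.exp u / h * G ((y - u) / h)) := by
    rw [← intervalIntegral_intervalIntegral_swap]
    · simp only [intervalIntegral.integral_const_mul, expSmoothing]
    · refine IntegrableOn.mono_set (t := Set.uIcc 0 (U + 1) ×ˢ Set.uIcc (-1) U)
        (ContinuousOn.integrableOn_compact (isCompact_uIcc.prod isCompact_uIcc) ?_)
        (Set.prod_mono Set.uIoc_subset_uIcc Set.uIoc_subset_uIcc)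
      refine Continuous.continuousOn ?_
      unfold Function.uncurry
      fun_prop
  have hc1 : Continuous fun u ↦ ∑ n ∈ Icc 1 N,
      a n * (Real.exp u / h * G ((Real.log n - u) / h)) := by fun_prop
  have hc2 : Continuous fun u ↦ ∫ y in (0 : ℝ)..U + 1,
      y ^ 3 * (Real.exp u / h * G ((y - u) / h)) := by
    refine intervalIntegral.continuous_parametric_intervalIntegral_of_continuous' ?_ _ _
    unfold Function.uncurry
    fun_prop
  rw [hsum, hint, ← intervalIntegral.integral_sub (hc1.intervalIntegrable _ _)
    (hc2.intervalIntegrable _ _), ← Real.norm_eq_abs]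
  have hc3 : Continuous fun u ↦ Real.exp u / h * (K / h) := by fun_prop
  refine (intervalIntegral.norm_integral_le_of_norm_le (by linarith) (Filter.Eventually.of_forall
    fun u hu ↦ ?_) (hc3.intervalIntegrable _ _)).trans ?_
  · have hfac : ∑ n ∈ Icc 1 N, a n * (Real.exp u / h * G ((Real.log n - u) / h)) -
        ∫ y in (0 : ℝ)..U + 1, y ^ 3 * (Real.exp u / h * G ((y - u) / h)) =
        Real.exp u / h * (∑ n ∈ Icc 1 N, a n * G ((Real.log n - u) / h) -
        ∫ y in (0 : ℝ)..U + 1, y ^ 3 * G ((y - u) / h)) := by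
      rw [mul_sub, mul_sum, ← intervalIntegral.integral_const_mul]
      congr 1
      · exact sum_congr rfl fun n _ ↦ by ring
      · exact intervalIntegral.integral_congr fun y _ ↦ by ring
    rw [hfac, norm_mul, Real.norm_of_nonneg (by positivity), Real.norm_eq_abs]
    exact mul_le_mul_of_nonneg_left (hK u ⟨hu.1.le, hu.2⟩) (by positivity)
  · rw [intervalIntegral.integral_mul_const, intervalIntegral.integral_div, integral_exp]
    calc (Real.exp U - Real.exp (-1)) / h * (K / h) ≤ Real.exp U / h * (K / h) := by
          gcongr
          linarith [Real.exp_pos (-1)]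
      _ = _ := by ring

open MeasureTheory in
theorem integral_pow_three_mul_expSmoothing_le {G : ℝ → ℝ} (hGc : Continuous G)
    (hG0 : ∀ v, 0 ≤ G v) (hGs : ∀ v, 1 < |v| → G v = 0) (hG1 : ∫ v, G v = 1) {h U : ℝ}
    (hh : 0 < h) (hU : 0 ≤ U) :
    ∫ y in (0 : ℝ)..U + 1, y ^ 3 * expSmoothing G h U y ≤
      (U + h) ^ 3 * Real.exp (U + 2 * h) := by
  have hE := continuous_expSmoothing hGc h U
  have hc : Continuous fun y ↦ y ^ 3 * expSmoothing G h U y := by fun_prop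
  have hzero : ∫ y in U + h..U + 1, y ^ 3 * expSmoothing G h U y ≤ 0 := by
    by_cases hh1 : h ≤ 1
    · rw [intervalIntegral.integral_of_le (by linarith), setIntegral_eq_zero_of_forall_eq_zero]
      intro y hy
      rw [expSmoothing_eq_zero hGs hh (by linarith) hy.1, mul_zero]
    · rw [intervalIntegral.integral_symm]
      refine neg_nonpos.mpr (intervalIntegral.integral_nonneg (by linarith) fun y hy ↦ ?_)
      exact mul_nonneg (pow_nonneg (by linarith [hy.1]) 3)
        (expSmoothing_nonneg hG0 hh (by linarith) y)
  rw [← intervalIntegral.integral_add_adjacent_intervals (hc.intervalIntegrable 0 (U + h))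
    (hc.intervalIntegrable _ _)]
  have hmain : ∫ y in (0 : ℝ)..U + h, y ^ 3 * expSmoothing G h U y ≤
      ∫ y in (0 : ℝ)..U + h, (U + h) ^ 3 * Real.exp (y + h) := by
    refine intervalIntegral.integral_mono_on (by linarith) (hc.intervalIntegrable _ _)
      (Continuous.intervalIntegrable (by fun_prop) _ _) fun y hy ↦ ?_
    refine mul_le_mul (pow_le_pow_left₀ hy.1 hy.2 3) (expSmoothing_le hGc hG0 hGs hG1 hh
      (by linarith) y) (expSmoothing_nonneg hG0 hh (by linarith) y) (by positivity)
  rw [intervalIntegral.integral_const_mul, intervalIntegral.integral_comp_add_right Real.exp h,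
    integral_exp] at hmain
  have : (U + h) ^ 3 * (Real.exp (U + h + h) - Real.exp (0 + h)) ≤
      (U + h) ^ 3 * Real.exp (U + 2 * h) := by
    refine mul_le_mul_of_nonneg_left ?_ (by positivity)
    rw [show U + h + h = U + 2 * h by ring]
    linarith [Real.exp_pos (0 + h)]
  linarith

theorem le_integral_pow_three_mul_exp {W : ℝ} (hW : 1 ≤ W) :
    Real.exp W * (W ^ 3 - 3 * W ^ 2) ≤ ∫ y in (0 : ℝ)..W, y ^ 3 * Real.exp y := by
  have hderiv : ∀ y ∈ Set.uIcc 0 W, HasDerivAt (fun y : ℝ ↦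
      (y ^ 3 - 3 * y ^ 2 + 6 * y - 6) * Real.exp y) (y ^ 3 * Real.exp y) y := by
    intro y _
    have h := (((((hasDerivAt_id y).pow 3).sub (((hasDerivAt_id y).pow 2).const_mul 3)).add
      ((hasDerivAt_id y).const_mul 6)).sub_const 6).mul (Real.hasDerivAt_exp y)
    refine h.congr_deriv ?_
    simp
    ring
  rw [intervalIntegral.integral_eq_sub_of_hasDerivAt hderiv
    (Continuous.intervalIntegrable (by fun_prop) _ _)]
  simp only [Real.exp_zero]
  nlinarith [Real.exp_pos W]

open MeasureTheory in
theorem le_integral_pow_three_mul_expSmoothing {G : ℝ → ℝ} (hGc : Continuous G)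
    (hG0 : ∀ v, 0 ≤ G v) (hGs : ∀ v, 1 < |v| → G v = 0) (hG1 : ∫ v, G v = 1) {h U : ℝ}
    (hh : 0 < h) (hh1 : h ≤ 1) (hU : 1 ≤ U - h) :
    Real.exp (U - 2 * h) * ((U - h) ^ 3 - 3 * (U - h) ^ 2) ≤
      ∫ y in (0 : ℝ)..U + 1, y ^ 3 * expSmoothing G h U y := by
  have hE := continuous_expSmoothing hGc h U
  have hc : Continuous fun y ↦ y ^ 3 * expSmoothing G h U y := by fun_prop
  rw [← intervalIntegral.integral_add_adjacent_intervals (hc.intervalIntegrable 0 (U - h))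
    (hc.intervalIntegrable _ _)]
  have h1 : 0 ≤ ∫ y in U - h..U + 1, y ^ 3 * expSmoothing G h U y :=
    intervalIntegral.integral_nonneg (by linarith) fun y hy ↦
      mul_nonneg (pow_nonneg (by linarith [hy.1]) 3) (expSmoothing_nonneg hG0 hh (by linarith) y)
  have h2 : ∫ y in (0 : ℝ)..U - h, Real.exp (-h) * (y ^ 3 * Real.exp y) ≤
      ∫ y in (0 : ℝ)..U - h, y ^ 3 * expSmoothing G h U y := by
    refine intervalIntegral.integral_mono_on (by linarith)
      (Continuous.intervalIntegrable (by fun_prop) _ _) (hc.intervalIntegrable _ _) fun y hy ↦ ?_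
    calc Real.exp (-h) * (y ^ 3 * Real.exp y) = y ^ 3 * Real.exp (y - h) := by
          rw [sub_eq_add_neg, Real.exp_add]; ring
      _ ≤ _ := mul_le_mul_of_nonneg_left (le_expSmoothing hGc hG0 hGs hG1 hh hh1 hy.1 hy.2)
          (pow_nonneg hy.1 3)
  rw [intervalIntegral.integral_const_mul] at h2
  have h3 := mul_le_mul_of_nonneg_left (le_integral_pow_three_mul_exp hU) (Real.exp_nonneg (-h))
  rw [← mul_assoc, ← Real.exp_add, show -h + (U - h) = U - 2 * h by ring] at h3
  linarith

theorem le_of_exp_mul_le_pow_three {T K L h : ℝ} (hK0 : 0 < K) (hL : 4 ≤ L) (hLh : L * h = 1)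
    (hh0 : 0 < h) (hh1 : h ≤ 1 / 4) (hup : Real.exp (-h) * T ≤
      (L + 2 * h) ^ 3 * Real.exp (L + 3 * h) + K * L ^ 2 * Real.exp (L + h)) :
    T ≤ Real.exp L * L ^ 3 + (7 * Real.exp 2 + 3 + 8 * K) * Real.exp L * L ^ 2 := by
  have hL0 : 0 < L := by linarith
  have hx := Real.exp_pos L
  have hexp2 : Real.exp (2 * h) ≤ 8 := by
    refine (Real.exp_le_exp.mpr (show 2 * h ≤ 1 by linarith)).trans ?_
    linarith [Real.exp_one_lt_d9]
  have hexp6 : Real.exp (6 * h) ≤ 1 + 6 * h * Real.exp 2 := by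
    have h1 := Real.add_one_le_exp (-(6 * h))
    have h2 : Real.exp (6 * h) * Real.exp (-(6 * h)) = 1 := by rw [← Real.exp_add]; simp
    have h3 : Real.exp (6 * h) ≤ Real.exp 2 := Real.exp_le_exp.mpr (by linarith)
    nlinarith [Real.exp_pos (6 * h)]
  have hup' : T ≤ Real.exp L * (L ^ 3 * Real.exp (6 * h) + K * L ^ 2 * Real.exp (2 * h)) := by
    have h1 : (L + 2 * h) ^ 3 ≤ L ^ 3 * Real.exp (2 * h) := by
      have h2 : L + 2 * h ≤ L * Real.exp (2 * h ^ 2) := by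
        have := mul_le_mul_of_nonneg_left (Real.add_one_le_exp (2 * h ^ 2)) hL0.le
        nlinarith
      calc (L + 2 * h) ^ 3 ≤ (L * Real.exp (2 * h ^ 2)) ^ 3 := by gcongr
        _ = L ^ 3 * Real.exp (6 * h ^ 2) := by
            rw [mul_pow, ← Real.exp_nat_mul]; ring_nf
        _ ≤ _ := mul_le_mul_of_nonneg_left (Real.exp_le_exp.mpr (by nlinarith)) (by positivity)
    calc T = Real.exp h * (Real.exp (-h) * T) := by
          rw [← mul_assoc, ← Real.exp_add]; simp
      _ ≤ Real.exp h * (L ^ 3 * Real.exp (2 * h) * Real.exp (L + 3 * h) +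
          K * L ^ 2 * Real.exp (L + h)) := by
          refine mul_le_mul_of_nonneg_left (hup.trans ?_) (Real.exp_nonneg _)
          gcongr
      _ = _ := by
          rw [show 6 * h = h + 2 * h + 3 * h by ring, show 2 * h = h + h by ring]
          simp only [Real.exp_add]
          ring
  have h1 : L ^ 3 * Real.exp (6 * h) ≤ L ^ 3 + 6 * Real.exp 2 * L ^ 2 := by
    calc L ^ 3 * Real.exp (6 * h) ≤ L ^ 3 * (1 + 6 * h * Real.exp 2) := by gcongr
      _ = L ^ 3 + 6 * Real.exp 2 * L ^ 2 * (L * h) := by ring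
      _ = _ := by rw [hLh, mul_one]
  have h2 : K * L ^ 2 * Real.exp (2 * h) ≤ K * L ^ 2 * 8 := by gcongr
  have h3 : L ^ 3 * Real.exp (6 * h) + K * L ^ 2 * Real.exp (2 * h) ≤
      L ^ 3 + (7 * Real.exp 2 + 3 + 8 * K) * L ^ 2 := by
    have : 0 ≤ (Real.exp 2 + 3) * L ^ 2 := by positivity
    linarith
  have h4 := mul_le_mul_of_nonneg_left h3 hx.le
  linarith


theorem le_of_pow_three_le_exp_mul {T K L h : ℝ} (hK0 : 0 < K) (hL : 4 ≤ L) (hLh : L * h = 1)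
    (hh0 : 0 < h) (hh1 : h ≤ 1 / 4) (hlow : Real.exp (L - 3 * h) *
      ((L - 2 * h) ^ 3 - 3 * (L - 2 * h) ^ 2) - K * L ^ 2 * Real.exp (L - h) ≤ Real.exp h * T) :
    Real.exp L * L ^ 3 - (7 * Real.exp 2 + 3 + 8 * K) * Real.exp L * L ^ 2 ≤ T := by
  have hL0 : 0 < L := by linarith
  have hx := Real.exp_pos L
  have hexp4 : 1 - 4 * h ≤ Real.exp (-(4 * h)) := by
    linarith [Real.add_one_le_exp (-(4 * h))]
  have hlow' : Real.exp L * (Real.exp (-(4 * h)) * ((L - 2 * h) ^ 3 - 3 * (L - 2 * h) ^ 2) -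
      K * L ^ 2 * Real.exp (-(2 * h))) ≤ T := by
    have h1 := mul_le_mul_of_nonneg_left hlow (Real.exp_nonneg (-h))
    rw [← mul_assoc (Real.exp (-h)) (Real.exp h), ← Real.exp_add, neg_add_cancel, Real.exp_zero,
      one_mul] at h1
    refine le_trans (le_of_eq ?_) h1
    have e3 : Real.exp (L - 3 * h) = Real.exp L * Real.exp (-(3 * h)) := by
      rw [← Real.exp_add, sub_eq_add_neg]
    have e1 : Real.exp (L - h) = Real.exp L * Real.exp (-h) := by
      rw [← Real.exp_add, sub_eq_add_neg]
    have e4 : Real.exp (-(4 * h)) = Real.exp (-h) * Real.exp (-(3 * h)) := by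
      rw [← Real.exp_add]; congr 1; ring
    have e2 : Real.exp (-(2 * h)) = Real.exp (-h) * Real.exp (-h) := by
      rw [← Real.exp_add]; congr 1; ring
    rw [e1, e2, e3, e4]
    ring
  have h1 : Real.exp (-(4 * h)) ≤ 1 := Real.exp_le_one_iff.mpr (by linarith)
  have h2 : Real.exp (-(2 * h)) ≤ 1 := Real.exp_le_one_iff.mpr (by linarith)
  have h3 : L ^ 3 - 6 * L ≤ (L - 2 * h) ^ 3 := by
    have : (L - 2 * h) ^ 3 = L ^ 3 - 6 * L * (L * h) + 12 * h * (L * h) - 8 * h ^ 3 := by ring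
    rw [this, hLh]
    nlinarith
  have h4 : L ^ 3 - 6 * L ^ 2 ≤ Real.exp (-(4 * h)) * (L - 2 * h) ^ 3 := by
    have h5 : (1 - 4 * h) * (L ^ 3 - 6 * L) ≤ Real.exp (-(4 * h)) * (L - 2 * h) ^ 3 :=
      mul_le_mul hexp4 h3 (by nlinarith) (Real.exp_nonneg _)
    have h6 : (1 - 4 * h) * (L ^ 3 - 6 * L) = L ^ 3 - 6 * L - 4 * L ^ 2 * (L * h) +
        24 * (L * h) := by ring
    rw [hLh] at h6
    nlinarith
  have h7 : Real.exp (-(4 * h)) * (3 * (L - 2 * h) ^ 2) ≤ 1 * (3 * L ^ 2) := by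
    gcongr
    · linarith
    · linarith
  have h8 : K * L ^ 2 * Real.exp (-(2 * h)) ≤ K * L ^ 2 * 1 := by gcongr
  have h9 : L ^ 3 - (7 * Real.exp 2 + 3 + 8 * K) * L ^ 2 ≤
      Real.exp (-(4 * h)) * ((L - 2 * h) ^ 3 - 3 * (L - 2 * h) ^ 2) -
      K * L ^ 2 * Real.exp (-(2 * h)) := by
    have h10 : 0 ≤ (7 * Real.exp 2 - 6 + 7 * K) * L ^ 2 :=
      mul_nonneg (by linarith [Real.add_one_le_exp 2]) (by positivity)
    linarith
  have h11 := mul_le_mul_of_nonneg_left h9 hx.le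
  linarith


open MeasureTheory in
theorem exists_abs_sum_vonMangoldt_mul_log_pow_three_sub_le :
    ∃ C : ℝ, 0 < C ∧ ∀ L : ℝ, 4 ≤ L →
      |∑ n ∈ Icc 1 ⌊Real.exp L⌋₊, ArithmeticFunction.vonMangoldt n * Real.log n ^ 3 -
        Real.exp L * L ^ 3| ≤ C * Real.exp L * L ^ 2 := by
  obtain ⟨G, g, hGc, hG0, hGs, hG1, hg, hgi, hgt, hG⟩ := exists_bump_fourier_representation
  obtain ⟨K, hK0, hK⟩ := exists_smoothed_sum_div_sub_integral_le hGc hGs hg hgi hgt hG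
  have key : ∀ h U : ℝ, 0 < h → h ≤ 1 → 0 ≤ U →
      |∑ n ∈ Icc 1 ⌈Real.exp (U + 1)⌉₊, ArithmeticFunction.vonMangoldt n * Real.log n ^ 3 / n *
        expSmoothing G h U (Real.log n) -
      ∫ y in (0 : ℝ)..U + 1, y ^ 3 * expSmoothing G h U y| ≤ K / h ^ 2 * Real.exp U := by
    intro h U hh hh1 hU
    refine abs_sum_mul_expSmoothing_sub_integral_le (G := G) hGc
      (a := fun n ↦ ArithmeticFunction.vonMangoldt n * Real.log n ^ 3 / n) hh hU fun u hu ↦ ?_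
    refine hK h u (U + 1) _ hh hh1 (by linarith) (by linarith [hu.2]) ?_
    refine le_trans (Real.exp_le_exp.mpr (by linarith [hu.2])) (Nat.le_ceil _)
  have ha0 : ∀ n : ℕ, 0 ≤ ArithmeticFunction.vonMangoldt n * Real.log n ^ 3 := fun n ↦
    mul_nonneg ArithmeticFunction.vonMangoldt_nonneg (pow_nonneg (Real.log_natCast_nonneg n) 3)
  refine ⟨7 * Real.exp 2 + 3 + 8 * K, by positivity, fun L hL ↦ ?_⟩
  set T := ∑ n ∈ Icc 1 ⌊Real.exp L⌋₊, ArithmeticFunction.vonMangoldt n * Real.log n ^ 3 with hT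
  set h : ℝ := 1 / L with hh
  have hL0 : 0 < L := by linarith
  have hh0 : 0 < h := by positivity
  have hh1 : h ≤ 1 / 4 := by rw [hh]; gcongr
  have hLh : L * h = 1 := by rw [hh]; field_simp
  have hlogle : ∀ n ∈ Icc 1 ⌊Real.exp L⌋₊, Real.log n ≤ L := fun n hn ↦ by
    have hn' := mem_Icc.mp hn
    rw [Real.log_le_iff_le_exp (by exact_mod_cast hn'.1)]
    exact (Nat.cast_le.mpr hn'.2).trans (Nat.floor_le (Real.exp_nonneg _))
  have hup : Real.exp (-h) * T ≤ (L + 2 * h) ^ 3 * Real.exp (L + 3 * h) +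
      K / h ^ 2 * Real.exp (L + h) := by
    have h1 := key h (L + h) hh0 (by linarith) (by linarith)
    have h2 := integral_pow_three_mul_expSmoothing_le hGc hG0 hGs hG1 hh0
      (show 0 ≤ L + h by linarith)
    have h3 : Real.exp (-h) * T ≤ ∑ n ∈ Icc 1 ⌈Real.exp (L + h + 1)⌉₊,
        ArithmeticFunction.vonMangoldt n * Real.log n ^ 3 / n *
        expSmoothing G h (L + h) (Real.log n) := by
      rw [hT, mul_sum]
      refine (sum_le_sum fun n hn ↦ ?_).trans (sum_le_sum_of_subset_of_nonneg
        (Icc_subset_Icc_right ?_) fun n _ _ ↦ ?_)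
      · have hn0 : (0 : ℝ) < n := by exact_mod_cast (mem_Icc.mp hn).1
        have h4 := le_expSmoothing hGc hG0 hGs hG1 hh0 (show h ≤ 1 by linarith)
          (Real.log_natCast_nonneg n) (U := L + h) (by linarith [hlogle n hn])
        rw [sub_eq_add_neg, Real.exp_add, Real.exp_log hn0] at h4
        calc _ = ArithmeticFunction.vonMangoldt n * Real.log n ^ 3 / n * (n * Real.exp (-h)) := by
              field_simp
          _ ≤ _ := mul_le_mul_of_nonneg_left h4 (div_nonneg (ha0 n) hn0.le)
      · refine Nat.floor_le_of_le (le_trans (Real.exp_le_exp.mpr ?_) (Nat.le_ceil _))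
        linarith
      · exact mul_nonneg (div_nonneg (ha0 n) (Nat.cast_nonneg n))
          (expSmoothing_nonneg hG0 hh0 (by linarith) _)
    rw [show L + h + h = L + 2 * h by ring, show L + h + 2 * h = L + 3 * h by ring] at h2
    linarith [(abs_le.mp h1).2]
  have hlow : Real.exp (L - 3 * h) * ((L - 2 * h) ^ 3 - 3 * (L - 2 * h) ^ 2) -
      K / h ^ 2 * Real.exp (L - h) ≤ Real.exp h * T := by
    have h1 := key h (L - h) hh0 (by linarith) (by linarith)
    have h2 := le_integral_pow_three_mul_expSmoothing hGc hG0 hGs hG1 hh0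
      (show h ≤ 1 by linarith) (show 1 ≤ L - h - h by linarith)
    have h3 : ∑ n ∈ Icc 1 ⌈Real.exp (L - h + 1)⌉₊,
        ArithmeticFunction.vonMangoldt n * Real.log n ^ 3 / n *
        expSmoothing G h (L - h) (Real.log n) ≤ Real.exp h * T := by
      rw [hT, mul_sum]
      rw [← sum_subset (s₁ := Icc 1 ⌊Real.exp L⌋₊)]
      · refine sum_le_sum fun n hn ↦ ?_
        have hn0 : (0 : ℝ) < n := by exact_mod_cast (mem_Icc.mp hn).1
        have h4 := expSmoothing_le hGc hG0 hGs hG1 hh0 (show -1 ≤ L - h by linarith) (Real.log n)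
        rw [Real.exp_add, Real.exp_log hn0] at h4
        calc _ ≤ ArithmeticFunction.vonMangoldt n * Real.log n ^ 3 / n * (n * Real.exp h) :=
              mul_le_mul_of_nonneg_left h4 (div_nonneg (ha0 n) hn0.le)
          _ = _ := by field_simp
      · refine Icc_subset_Icc_right (Nat.floor_le_of_le (le_trans (Real.exp_le_exp.mpr ?_)
          (Nat.le_ceil _)))
        linarith
      · intro n hn hn'
        have hn1 := (mem_Icc.mp hn).1
        have : ⌊Real.exp L⌋₊ < n := by
          by_contra hcon
          exact hn' (mem_Icc.mpr ⟨hn1, not_lt.mp hcon⟩)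
        rw [expSmoothing_eq_zero hGs hh0 (by linarith), mul_zero]
        rw [sub_add_cancel, Real.lt_log_iff_exp_lt (by exact_mod_cast hn1)]
        exact Nat.lt_of_floor_lt this
    rw [show L - h - h = L - 2 * h by ring, show L - h - 2 * h = L - 3 * h by ring] at h2
    linarith [(abs_le.mp h1).1]
  have hKh : K / h ^ 2 = K * L ^ 2 := by rw [hh]; field_simp
  rw [hKh] at hup hlow
  have h1 := le_of_exp_mul_le_pow_three hK0 hL hLh hh0 hh1 hup
  have h2 := le_of_pow_three_le_exp_mul hK0 hL hLh hh0 hh1 hlow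
  exact abs_le.mpr ⟨by linarith, by linarith⟩

theorem log_le_div_four {L : ℝ} (hL : 100 ≤ L) : Real.log L ≤ L / 4 := by
  have h1 : Real.log (L / 16) ≤ L / 16 - 1 := Real.log_le_sub_one_of_pos (by positivity)
  rw [Real.log_div (by linarith) (by norm_num), show (16 : ℝ) = 2 ^ 4 by norm_num,
    Real.log_pow] at h1
  push_cast at h1
  linarith [Real.log_two_lt_d9]

theorem one_le_log_of_hundred_le {L : ℝ} (hL : 100 ≤ L) : 1 ≤ Real.log L := by
  rw [Real.le_log_iff_exp_le (by linarith)]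
  linarith [Real.exp_one_lt_d9]

theorem sum_vonMangoldt_mul_log_pow_three_le {L : ℝ} (hL : 0 < L) :
    ∑ n ∈ Icc 1 ⌊Real.exp L⌋₊, ArithmeticFunction.vonMangoldt n * Real.log n ^ 3 ≤
      (⌊Real.exp L⌋₊.primeCounting : ℝ) * L ^ 4 := by
  have h1 : ∑ n ∈ Icc 1 ⌊Real.exp L⌋₊, ArithmeticFunction.vonMangoldt n * Real.log n ^ 3 ≤
      Chebyshev.psi (Real.exp L) * L ^ 3 := by
    rw [Chebyshev.psi, sum_mul]
    refine (sum_le_sum fun n hn ↦ ?_)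
    have hn' := mem_Icc.mp hn
    refine mul_le_mul_of_nonneg_left (pow_le_pow_left₀ (Real.log_natCast_nonneg n) ?_ 3)
      ArithmeticFunction.vonMangoldt_nonneg
    rw [Real.log_le_iff_le_exp (by exact_mod_cast hn'.1)]
    exact (Nat.cast_le.mpr hn'.2).trans (Nat.floor_le (Real.exp_nonneg _))
  have h2 := Chebyshev.psi_le_primeCounting_mul_log' (Real.exp L)
  rw [Real.log_exp] at h2
  calc _ ≤ _ := h1
    _ ≤ _ := mul_le_mul_of_nonneg_right h2 (by positivity)
    _ = _ := by ring

theorem primeCounting_mul_pow_four_le {L M : ℝ} (hM : 0 < M) :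
    (⌊Real.exp L⌋₊.primeCounting : ℝ) * M ^ 4 ≤ Real.exp M * M ^ 4 +
      ∑ n ∈ Icc 1 ⌊Real.exp L⌋₊, ArithmeticFunction.vonMangoldt n * Real.log n ^ 3 := by
  set N := ⌊Real.exp L⌋₊
  have hsmall : (((Nat.primesLE N).filter fun p : ℕ ↦ (p : ℝ) ≤ Real.exp M).card : ℝ) ≤
      Real.exp M := by
    have hsub : ((Nat.primesLE N).filter fun p : ℕ ↦ (p : ℝ) ≤ Real.exp M) ⊆
        Icc 1 ⌊Real.exp M⌋₊ := fun p hp ↦ by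
      rw [mem_filter, Nat.mem_primesLE] at hp
      exact mem_Icc.mpr ⟨hp.1.2.one_lt.le, Nat.le_floor hp.2⟩
    have hcard := card_le_card hsub
    rw [Nat.card_Icc, Nat.add_sub_cancel] at hcard
    exact (Nat.cast_le.mpr hcard).trans (Nat.floor_le (Real.exp_nonneg _))
  have hlarge : ∑ p ∈ (Nat.primesLE N).filter (fun p : ℕ ↦ ¬ (p : ℝ) ≤ Real.exp M), M ^ 4 ≤
      ∑ n ∈ Icc 1 N, ArithmeticFunction.vonMangoldt n * Real.log n ^ 3 := by
    refine (sum_le_sum fun p hp ↦ ?_).trans (sum_le_sum_of_subset_of_nonneg (fun p hp ↦ ?_)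
      fun n _ _ ↦ mul_nonneg ArithmeticFunction.vonMangoldt_nonneg
        (pow_nonneg (Real.log_natCast_nonneg n) 3))
    · rw [mem_filter, Nat.mem_primesLE, not_le] at hp
      have hlog : M ≤ Real.log p := (Real.le_log_iff_exp_le (by
        exact_mod_cast hp.1.2.pos)).mpr hp.2.le
      rw [ArithmeticFunction.vonMangoldt_apply_prime hp.1.2, ← pow_succ']
      exact pow_le_pow_left₀ hM.le hlog 4
    · rw [mem_filter, Nat.mem_primesLE] at hp
      exact mem_Icc.mpr ⟨hp.1.2.one_lt.le, hp.1.1⟩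
  have hsplit := card_filter_add_card_filter_not (s := Nat.primesLE N)
    (fun p : ℕ ↦ (p : ℝ) ≤ Real.exp M)
  rw [sum_const, nsmul_eq_mul] at hlarge
  rw [← Nat.primesLE_card_eq_primeCounting, ← hsplit, Nat.cast_add, add_mul]
  exact add_le_add (mul_le_mul_of_nonneg_right hsmall (by positivity)) hlarge

theorem exists_abs_primeCounting_exp_sub_le :
    ∃ C : ℝ, 0 < C ∧ ∀ L : ℝ, 100 ≤ L → |(⌊Real.exp L⌋₊.primeCounting : ℝ) - Real.exp L / L| ≤
      C * (Real.exp L * Real.log L / L ^ 2) := by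
  obtain ⟨C, hC0, hC⟩ := exists_abs_sum_vonMangoldt_mul_log_pow_three_sub_le
  refine ⟨61 + 16 * C, by positivity, fun L hL ↦ ?_⟩
  have hT := abs_le.mp (hC L (by linarith))
  have hL0 : 0 < L := by linarith
  have hl1 := one_le_log_of_hundred_le hL
  have hl2 := log_le_div_four hL
  have hlow := sum_vonMangoldt_mul_log_pow_three_le hL0
  have hx := Real.exp_pos L
  set l := Real.log L with hl
  set x := Real.exp L with hxL
  set P : ℝ := (⌊x⌋₊.primeCounting : ℝ) with hP
  set T := ∑ n ∈ Icc 1 ⌊x⌋₊, ArithmeticFunction.vonMangoldt n * Real.log n ^ 3 with hTdef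
  have hup := primeCounting_mul_pow_four_le (L := L) (M := L - 2 * l) (by linarith)
  rw [← hTdef, ← hP] at hup
  have hexp : Real.exp (L - 2 * l) = x / L ^ 2 := by
    rw [Real.exp_sub, mul_comm, Real.exp_mul, hl, Real.exp_log hL0]
    norm_cast
  rw [hexp] at hup
  set M := L - 2 * l with hMdef
  have hM0 : 0 < M := by linarith
  have hML : L ≤ 2 * M := by linarith
  rw [abs_le]
  constructor
  · have h1 : x / L - C * (x / L ^ 2) ≤ P := by
      rw [← mul_le_mul_iff_left₀ (show 0 < L ^ 4 by positivity)]
      calc (x / L - C * (x / L ^ 2)) * L ^ 4 = x * L ^ 3 - C * x * L ^ 2 := by field_simp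
        _ ≤ P * L ^ 4 := by linarith
    have h2 : C * (x / L ^ 2) ≤ (61 + 16 * C) * (x * l / L ^ 2) := by
      have h3 : x / L ^ 2 ≤ x * l / L ^ 2 := by
        gcongr
        nlinarith
      refine mul_le_mul (by linarith) h3 (by positivity) (by positivity)
    linarith
  · have h1 : L ^ 4 ≤ M ^ 4 * (1 + 60 * (l / L)) := by
      set t := 2 * l / M with ht
      have hLt : L = M * (1 + t) := by
        rw [ht, mul_add, mul_div_cancel₀ _ hM0.ne', hMdef]
        ring
      have ht0 : 0 ≤ t := by positivity
      have ht1 : t ≤ 1 := by rw [ht, div_le_one hM0]; linarith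
      have h2 : (1 + t) ^ 4 ≤ 1 + 15 * t := by
        have e2 : t ^ 2 ≤ t := by nlinarith
        have e3 : t ^ 3 ≤ t := by nlinarith
        have e4 : t ^ 4 ≤ t := by nlinarith
        nlinarith
      have h3 : t ≤ 4 * (l / L) := by
        rw [ht, ← mul_div_assoc, div_le_div_iff₀ hM0 hL0]
        nlinarith
      calc L ^ 4 = M ^ 4 * (1 + t) ^ 4 := by rw [← mul_pow, ← hLt]
        _ ≤ _ := by gcongr; linarith
    have h16 : L ^ 4 ≤ 16 * M ^ 4 := by
      calc L ^ 4 ≤ (2 * M) ^ 4 := by gcongr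
        _ = _ := by ring
    have hTx : T ≤ (x / L + C * (x / L ^ 2)) * L ^ 4 := by
      calc T ≤ x * L ^ 3 + C * x * L ^ 2 := by linarith
        _ = _ := by field_simp
    have h4 : P ≤ x / L ^ 2 + x / L * (1 + 60 * (l / L)) + C * (x / L ^ 2) * 16 := by
      rw [← mul_le_mul_iff_left₀ (show 0 < M ^ 4 by positivity)]
      have h5 : x / L * L ^ 4 ≤ x / L * (M ^ 4 * (1 + 60 * (l / L))) := by gcongr
      have h6 : C * (x / L ^ 2) * L ^ 4 ≤ C * (x / L ^ 2) * (16 * M ^ 4) := by gcongr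
      linarith
    have h7 : x / L * (1 + 60 * (l / L)) = x / L + 60 * (x * l / L ^ 2) := by
      field_simp
    have h8 : x / L ^ 2 ≤ x * l / L ^ 2 := by
      gcongr
      nlinarith
    have h9 : C * (x / L ^ 2) ≤ C * (x * l / L ^ 2) := by gcongr
    linarith

theorem exists_abs_primeCounting_sub_div_le :
    ∃ C : ℝ, 0 < C ∧ ∀ L : ℝ, 200 ≤ L → ∀ m : ℕ, (m : ℝ) ≤ Real.exp L →
      |(m.primeCounting : ℝ) - m / L| ≤ C * (Real.exp L * Real.log L / L ^ 2) := by
  obtain ⟨C, hC0, hC⟩ := exists_abs_primeCounting_exp_sub_le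
  refine ⟨4 * C + 4, by positivity, fun L hL m hm ↦ ?_⟩
  have hL0 : 0 < L := by linarith
  have hl1 := one_le_log_of_hundred_le (show 100 ≤ L by linarith)
  have hl2 := log_le_div_four (show 100 ≤ L by linarith)
  have hx := Real.exp_pos L
  have hE : Real.exp L / L ^ 2 ≤ Real.exp L * Real.log L / L ^ 2 := by
    gcongr
    nlinarith
  have hE0 : 0 ≤ Real.exp L * Real.log L / L ^ 2 := by positivity
  rcases le_or_gt (m : ℝ) (Real.exp L / L ^ 2) with h | h
  · have h1 : (m.primeCounting : ℝ) ≤ m := by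
      rw [← Nat.primesLE_card_eq_primeCounting, Nat.primesLE_eq_filter_Icc_one]
      have h2 := card_filter_le (Icc 1 m) Nat.Prime
      rw [Nat.card_Icc, Nat.add_sub_cancel] at h2
      exact_mod_cast h2
    have h2 : (m : ℝ) / L ≤ m := div_le_self (Nat.cast_nonneg m) (by linarith)
    have h3 : (0 : ℝ) ≤ (m : ℝ) / L := by positivity
    have h4 : (0 : ℝ) ≤ (m.primeCounting : ℝ) := Nat.cast_nonneg _
    have h5 : 0 ≤ (4 * C + 3) * (Real.exp L * Real.log L / L ^ 2) := by positivity
    rw [abs_le]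
    constructor <;> linarith
  · have hm0 : (0 : ℝ) < m := lt_trans (by positivity) h
    set M := Real.log m with hM
    have hexp : Real.exp M = m := Real.exp_log hm0
    have hML : M ≤ L := (Real.log_le_iff_le_exp hm0).mpr hm
    have hLM : L - 2 * Real.log L ≤ M := by
      rw [hM, Real.le_log_iff_exp_le hm0]
      refine le_trans (le_of_eq ?_) h.le
      rw [Real.exp_sub, mul_comm, Real.exp_mul, Real.exp_log hL0]
      norm_cast
    have hL2 : L ≤ 2 * M := by linarith
    have hM0 : 0 < M := by linarith
    have h1 := hC M (by linarith)
    rw [hexp, Nat.floor_natCast] at h1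
    have h2 : (m : ℝ) * Real.log M / M ^ 2 ≤ 4 * (Real.exp L * Real.log L / L ^ 2) := by
      have h3 : (m : ℝ) * Real.log M ≤ Real.exp L * Real.log L :=
        mul_le_mul hm (Real.log_le_log hM0 hML) (Real.log_nonneg (by linarith)) hx.le
      have h4 : L ^ 2 ≤ 4 * M ^ 2 := by nlinarith
      rw [← mul_div_assoc, div_le_div_iff₀ (by positivity) (by positivity)]
      calc (m : ℝ) * Real.log M * L ^ 2 ≤ Real.exp L * Real.log L * (4 * M ^ 2) := by gcongr
        _ = _ := by ring
    have h5 : (m : ℝ) / M - m / L ≤ 4 * (Real.exp L * Real.log L / L ^ 2) := by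
      have h6 : (m : ℝ) / M - m / L = m * (L - M) / (M * L) := by field_simp
      rw [h6, ← mul_div_assoc, div_le_div_iff₀ (by positivity) (by positivity)]
      calc (m : ℝ) * (L - M) * L ^ 2 ≤ Real.exp L * (2 * Real.log L) * (2 * M * L) := by
            have : L ^ 2 ≤ 2 * M * L := by nlinarith
            exact mul_le_mul (mul_le_mul hm (by linarith) (by linarith) hx.le) this (sq_nonneg L)
              (by positivity)
        _ = _ := by ring
    have h7 : (m : ℝ) / L ≤ m / M := by gcongr
    have h8 := mul_le_mul_of_nonneg_left h2 hC0.le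
    have h9 := abs_le.mp h1
    rw [abs_le]
    constructor <;> linarith

theorem sum_primesLE_tsub_eq_sum_primeCounting (N : ℕ) :
    ∑ p ∈ Nat.primesLE N, (N - p) = ∑ m ∈ range N, m.primeCounting := by
  induction N with
  | zero => simp
  | succ N ih =>
    rw [sum_range_succ, ← ih, ← Nat.primesLE_card_eq_primeCounting, card_eq_sum_ones,
      ← sum_add_distrib]
    symm
    refine sum_subset_zero_on_sdiff (Nat.primesLE_mono N.le_succ) (fun p hp ↦ ?_) fun p hp ↦ ?_
    · rw [mem_sdiff, Nat.mem_primesLE, Nat.mem_primesLE] at hp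
      have : ¬ p ≤ N := fun h ↦ hp.2 ⟨h, hp.1.2⟩
      omega
    · have := Nat.le_of_mem_primesLE hp
      omega

theorem Q_eq_sum_primeCounting (x : ℝ) :
    Q x = ∑ p ∈ Nat.primesLE ⌊x⌋₊, (⌊x⌋₊ - p).primeCounting := by
  set N := ⌊x⌋₊ with hN
  have h : ((Icc 1 N ×ˢ Icc 1 N).filter
      fun pq : ℕ × ℕ ↦ pq.1.Prime ∧ pq.2.Prime ∧ pq.1 + pq.2 ≤ N).card =
      ((Nat.primesLE N).sigma fun p ↦ Nat.primesLE (N - p)).card := by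
    refine card_bij' (fun pq _ ↦ ⟨pq.1, pq.2⟩) (fun s _ ↦ (s.1, s.2)) ?_ ?_ ?_ ?_
    · rintro ⟨p, q⟩ h
      simp only [mem_filter, mem_product, mem_Icc] at h
      simp only [mem_sigma, Nat.mem_primesLE]
      exact ⟨⟨by omega, h.2.1⟩, by omega, h.2.2.1⟩
    · rintro ⟨p, q⟩ h
      simp only [mem_sigma, Nat.mem_primesLE] at h
      have hp := h.1.2.pos
      have hq := h.2.2.pos
      simp only [mem_filter, mem_product, mem_Icc]
      exact ⟨⟨⟨by omega, by omega⟩, by omega, by omega⟩, h.1.2, h.2.2, by omega⟩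
    · intros; rfl
    · intros; rfl
  rw [Q, ← hN, h, card_sigma]
  exact sum_congr rfl fun p _ ↦ Nat.primesLE_card_eq_primeCounting _

theorem exists_abs_Q_sub_le :
    ∃ C : ℝ, 0 < C ∧ ∀ L : ℝ, 200 ≤ L →
      |(Q (Real.exp L) : ℝ) - Real.exp L ^ 2 / (2 * L ^ 2)| ≤
        C * (Real.exp L ^ 2 * Real.log L / L ^ 3) := by
  obtain ⟨C, hC0, hC⟩ := exists_abs_primeCounting_sub_div_le
  refine ⟨(1 + C) * C + C + 4, by positivity, fun L hL ↦ ?_⟩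
  have hL0 : 0 < L := by linarith
  have hl1 := one_le_log_of_hundred_le (show 100 ≤ L by linarith)
  have hl2 := log_le_div_four (show 100 ≤ L by linarith)
  have hx := Real.exp_pos L
  specialize hC L hL
  rw [Q_eq_sum_primeCounting]
  set x := Real.exp L with hxL
  set l := Real.log L
  set E := x * l / L ^ 2 with hE
  set N := ⌊x⌋₊
  have hNx : (N : ℝ) ≤ x := Nat.floor_le hx.le
  have hxN : x < N + 1 := Nat.lt_floor_add_one x
  have hE0 : 0 ≤ E := by positivity
  have hEx : E ≤ x / L := by
    rw [hE, div_le_div_iff₀ (by positivity) hL0]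
    calc x * l * L ≤ x * L * L := by gcongr; linarith
      _ = _ := by ring
  have hE1 : 1 / 2 ≤ E := by
    rw [hE, div_le_div_iff₀ (by norm_num) (by positivity)]
    have h1 := Real.quadratic_le_exp_of_nonneg hL0.le
    have h2 : x * 1 ≤ x * l := by gcongr
    linarith
  have hgoal : x ^ 2 * l / L ^ 3 = x * E / L := by rw [hE]; field_simp
  rw [hgoal]
  have hpi : ((Nat.primesLE N).card : ℝ) ≤ (1 + C) * (x / L) := by
    rw [Nat.primesLE_card_eq_primeCounting]
    have h1 := (abs_le.mp (hC N hNx)).2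
    have h2 : (N : ℝ) / L ≤ x / L := by gcongr
    have h3 : C * E ≤ C * (x / L) := by gcongr
    linarith
  have hA : |((∑ p ∈ Nat.primesLE N, (N - p).primeCounting : ℕ) : ℝ) -
      ((∑ p ∈ Nat.primesLE N, (N - p) : ℕ) : ℝ) / L| ≤ (1 + C) * (x / L) * (C * E) := by
    rw [Nat.cast_sum, Nat.cast_sum, sum_div, ← sum_sub_distrib]
    refine (abs_sum_le_sum_abs _ _).trans ((sum_le_sum fun p _ ↦ hC (N - p) ?_).trans ?_)
    · exact le_trans (by exact_mod_cast Nat.sub_le N p) hNx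
    · rw [sum_const, nsmul_eq_mul]
      gcongr
  have hB : |((∑ p ∈ Nat.primesLE N, (N - p) : ℕ) : ℝ) - (∑ m ∈ range N, (m : ℝ)) / L| ≤
      x * (C * E) := by
    rw [sum_primesLE_tsub_eq_sum_primeCounting, Nat.cast_sum, sum_div, ← sum_sub_distrib]
    refine (abs_sum_le_sum_abs _ _).trans ((sum_le_sum fun m hm ↦ hC m ?_).trans ?_)
    · exact le_trans (by exact_mod_cast (mem_range.mp hm).le) hNx
    · rw [sum_const, nsmul_eq_mul, card_range]
      gcongr
  have hG : ∑ m ∈ range N, (m : ℝ) = N * (N - 1) / 2 := by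
    clear_value N
    clear hA hB hpi hNx hxN
    induction N with
    | zero => simp
    | succ n ih => rw [sum_range_succ, ih]; push_cast; ring
  have hx1 : 1 ≤ x := Real.one_le_exp hL0.le
  have hD : |(N : ℝ) * (N - 1) / 2 - x ^ 2 / 2| ≤ 2 * x := by
    rw [abs_le]
    constructor <;> nlinarith
  rw [hG] at hB
  set S : ℝ := ((∑ p ∈ Nat.primesLE N, (N - p) : ℕ) : ℝ)
  set R : ℝ := ((∑ p ∈ Nat.primesLE N, (N - p).primeCounting : ℕ) : ℝ)
  set V : ℝ := (N : ℝ) * (N - 1) / 2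
  have hsplit : R - x ^ 2 / (2 * L ^ 2) =
      (R - S / L) + (S - V / L) / L + (V - x ^ 2 / 2) / L ^ 2 := by
    field_simp
    ring
  have hB' : |(S - V / L) / L| ≤ x * (C * E) / L := by
    rw [abs_div, abs_of_pos hL0]
    gcongr
  have hD' : |(V - x ^ 2 / 2) / L ^ 2| ≤ 4 * x * E / L := by
    rw [abs_div, abs_of_pos (show 0 < L ^ 2 by positivity), div_le_div_iff₀ (by positivity) hL0]
    have h1 : 2 * x ≤ 4 * x * E := by nlinarith
    have h2 : L ≤ L ^ 2 := by nlinarith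
    exact mul_le_mul (hD.trans h1) h2 hL0.le (by positivity)
  rw [hsplit]
  calc _ ≤ |R - S / L| + |(S - V / L) / L| + |(V - x ^ 2 / 2) / L ^ 2| := abs_add_three _ _ _
    _ ≤ (1 + C) * (x / L) * (C * E) + x * (C * E) / L + 4 * x * E / L := by gcongr
    _ = _ := by ring

theorem Q_le_sq (x : ℝ) (hx : 0 ≤ x) : (Q x : ℝ) ≤ x ^ 2 := by
  have h1 : Q x ≤ ⌊x⌋₊ * ⌊x⌋₊ := by
    refine (card_filter_le _ _).trans (le_of_eq ?_)
    rw [card_product, Nat.card_Icc, Nat.add_sub_cancel]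
  have h2 : (Q x : ℝ) ≤ ⌊x⌋₊ * ⌊x⌋₊ := by exact_mod_cast h1
  rw [sq]
  exact h2.trans (mul_self_le_mul_self (Nat.cast_nonneg _) (Nat.floor_le hx))

theorem Q_asymptotic :
    ∃ C : ℝ, 0 < C ∧ ∀ x : ℝ, 3 ≤ x →
      |(Q x : ℝ) - x ^ 2 / (2 * (Real.log x) ^ 2)| ≤
        C * x ^ 2 * Real.log (Real.log x) / (Real.log x) ^ 3 := by
  obtain ⟨C, hC0, hC⟩ := exists_abs_Q_sub_le
  have hlog3 : 1 < Real.log 3 := by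
    rw [Real.lt_log_iff_exp_lt (by norm_num)]
    linarith [Real.exp_one_lt_d9]
  have hc : 0 < Real.log (Real.log 3) := Real.log_pos hlog3
  refine ⟨C + 200 ^ 3 / Real.log (Real.log 3), by positivity, fun x hx ↦ ?_⟩
  have hx0 : 0 < x := by linarith
  have hL3 : Real.log 3 ≤ Real.log x := Real.log_le_log (by norm_num) hx
  have hL0 : 0 < Real.log x := by linarith
  have hl3 : Real.log (Real.log 3) ≤ Real.log (Real.log x) := Real.log_le_log (by linarith) hL3
  have hl0 := hc.trans_le hl3
  rw [mul_assoc, mul_div_assoc, add_mul]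
  have hpos : 0 ≤ x ^ 2 * Real.log (Real.log x) / Real.log x ^ 3 := by positivity
  rcases le_or_gt 200 (Real.log x) with h | h
  · have h1 := hC (Real.log x) h
    rw [Real.exp_log hx0] at h1
    refine h1.trans (le_add_of_nonneg_right ?_)
    positivity
  · have h1 : |(Q x : ℝ) - x ^ 2 / (2 * (Real.log x) ^ 2)| ≤ x ^ 2 := by
      have h2 := Q_le_sq x hx0.le
      have h3 : x ^ 2 / (2 * (Real.log x) ^ 2) ≤ x ^ 2 := div_le_self (by positivity) (by nlinarith)
      have h4 : 0 ≤ x ^ 2 / (2 * (Real.log x) ^ 2) := by positivity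
      have h5 : (0 : ℝ) ≤ Q x := Nat.cast_nonneg _
      rw [abs_le]
      constructor <;> linarith
    have h6 : x ^ 2 ≤ 200 ^ 3 / Real.log (Real.log 3) *
        (x ^ 2 * Real.log (Real.log x) / Real.log x ^ 3) := by
      rw [div_mul_div_comm, le_div_iff₀ (by positivity)]
      have h7 : Real.log x ^ 3 ≤ 200 ^ 3 := by gcongr
      calc x ^ 2 * (Real.log (Real.log 3) * Real.log x ^ 3) ≤
          x ^ 2 * (Real.log (Real.log x) * 200 ^ 3) := by gcongr
        _ = _ := by ring
    exact h1.trans (h6.trans (le_add_of_nonneg_left (by positivity)))
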